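/- arXiv:2212.13687 — 4 statements merged into one kernel-verified Lean document; each statement's English description precedes it below -/
import Mathlib

section
/- Let χ be an odd Dirichlet character modulo N (N > 2) and let n ≥ 1 be an integer. Then L(2n+1, χ) = (π^{2n+1} / ((2n)! N^{2n+1})) · ∑_{i=1}^{n} b_{n,i} · L̃_{ℤ/Nℤ}(i, χ). -/
open Finset Filter Real

/-- The number of cyclic descents of a permutation `σ` of `{0, …, n-1}`, read cyclically:
positions `i` with `σ(i) > σ(i+1)`, indices mod `n`. -/
def cyclicDescents (n : ℕ) (σ : Equiv.Perm (Fin n)) : ℕ :=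
  (Finset.univ.filter (fun i : Fin n => σ (finRotate n i) < σ i)).card

/-- The circular Eulerian number `Ā(n,l)`: the number of circular `n`-permutations with exactly
`l` descents.  Each circular permutation has exactly `n` linear representatives (all with the
same number of cyclic descents), whence the division by `n`. -/
def circEulerian (n l : ℕ) : ℕ :=
  (Finset.univ.filter (fun σ : Equiv.Perm (Fin n) => cyclicDescents n σ = l)).card / n

/-- The coefficient `t(k,i) = (-1)^(k-i) 2^(2i) (k/(k+i)) C(k+i, k-i)` of the Chebyshev
polynomial of the first kind, with the convention `t(0,0) = 1/2`. -/
noncomputable def tCoeff (k i : ℕ) : ℝ :=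
  if k = 0 ∧ i = 0 then 1 / 2
  else (-1) ^ (k - i) * 2 ^ (2 * i) * ((k : ℝ) / ((k : ℝ) + (i : ℝ))) *
    (Nat.choose (k + i) (k - i) : ℝ)

/-- The coefficient `u(k,i) = (-1)^(k-i) 2^(2i) C(k+i, k-i)` of the Chebyshev polynomial of the
second kind. -/
noncomputable def uCoeff (k i : ℕ) : ℝ :=
  (-1) ^ (k - i) * 2 ^ (2 * i) * (Nat.choose (k + i) (k - i) : ℝ)

/-- `a_{n,i} = 2 ∑_{l=1}^{i} (-1)^(n-l) t(n-l, n-i) Ā(2n, l)`. -/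
noncomputable def aCoeff (n i : ℕ) : ℝ :=
  2 * ∑ l ∈ Finset.Icc 1 i, (-1) ^ (n - l) * tCoeff (n - l) (n - i) *
    (circEulerian (2 * n) l : ℝ)

/-- `b_{n,i} = ∑_{l=1}^{i} (-1)^(n-l) u(n-l, n-i) Ā(2n+1, l)`. -/
noncomputable def bCoeff (n i : ℕ) : ℝ :=
  ∑ l ∈ Finset.Icc 1 i, (-1) ^ (n - l) * uCoeff (n - l) (n - i) *
    (circEulerian (2 * n + 1) l : ℝ)

open Equiv in
/-- insert the maximum at position `p`. -/
def insMax {m : ℕ} (p : Fin (m + 1)) (τ : Equiv.Perm (Fin m)) : Equiv.Perm (Fin (m + 1)) :=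
  (finSuccEquiv' p).trans ((Equiv.optionCongr τ).trans (finSuccEquiv' (Fin.last m)).symm)

lemma insMax_self {m : ℕ} (p : Fin (m + 1)) (τ : Equiv.Perm (Fin m)) :
    insMax p τ p = Fin.last m := by
  simp [insMax]

lemma insMax_succAbove {m : ℕ} (p : Fin (m + 1)) (τ : Equiv.Perm (Fin m)) (j : Fin m) :
    insMax p τ (p.succAbove j) = (τ j).castSucc := by
  simp [insMax]

lemma insMax_bijective (m : ℕ) :
    Function.Bijective (fun x : Fin (m + 1) × Equiv.Perm (Fin m) => insMax x.1 x.2) := by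
  rw [Fintype.bijective_iff_injective_and_card]
  constructor
  · rintro ⟨p, τ⟩ ⟨q, ρ⟩ h
    simp only at h
    have hpq : p = q := by
      apply (insMax p τ).injective
      rw [insMax_self, h, insMax_self]
    subst hpq
    congr 1
    ext j
    have := congrArg (fun s => s (p.succAbove j)) h
    simp only [insMax_succAbove] at this
    exact congrArg Fin.val (Fin.castSucc_injective _ this)
  · simp [Fintype.card_perm, Nat.factorial_succ]

/-- The word `0 τ 0 0 ...`. -/
def wd {m : ℕ} (τ : Equiv.Perm (Fin m)) : ℕ → ℕ
  | 0 => 0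
  | i + 1 => if h : i < m then (τ ⟨i, h⟩ : ℕ) + 1 else 0

lemma wd_le {m : ℕ} (τ : Equiv.Perm (Fin m)) (i : ℕ) : wd τ i ≤ m := by
  cases i with
  | zero => simp [wd]
  | succ i =>
    simp only [wd]
    split_ifs with h
    · exact (τ ⟨i, h⟩).2
    · simp

lemma wd_ins {m : ℕ} (p : Fin (m + 1)) (τ : Equiv.Perm (Fin m)) (i : ℕ) :
    wd (insMax p τ) i =
      if i ≤ p then wd τ i else if i = p + 1 then m + 1 else wd τ (i - 1) := by
  cases i with
  | zero => simp [wd]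
  | succ i =>
    have hp := p.2
    by_cases h1 : i < p
    · have h2 : i < m := by omega
      have : (⟨i, by omega⟩ : Fin (m + 1)) = p.succAbove ⟨i, h2⟩ := by
        rw [Fin.succAbove_of_castSucc_lt]
        · rfl
        · exact h1
      rw [if_pos (by omega)]
      simp only [wd, dif_pos h2, dif_pos (show i < m + 1 by omega)]
      rw [this, insMax_succAbove]; simp
    · rw [if_neg (by omega)]
      by_cases h3 : i = p
      · subst h3
        simp [wd, insMax_self, Nat.le_of_lt_succ hp]
      · rw [if_neg (by omega)]
        obtain ⟨j, rfl⟩ : ∃ j, i = j + 1 := ⟨i - 1, by omega⟩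
        simp only [wd, Nat.add_sub_cancel]
        by_cases h4 : j < m
        · have : (⟨j + 1, by omega⟩ : Fin (m + 1)) = p.succAbove ⟨j, h4⟩ := by
            rw [Fin.succAbove_of_le_castSucc]
            · rfl
            · rw [Fin.le_def]; simp; omega
          simp only [dif_pos h4, dif_pos (show j + 1 < m + 1 by omega)]
          rw [this, insMax_succAbove]; simp
        · rw [dif_neg h4, dif_neg (by omega)]

/-- number of descents in the first `k` steps -/
def dsw (w : ℕ → ℕ) (k : ℕ) : ℕ := ∑ i ∈ Finset.range k, if w (i + 1) < w i then 1 else 0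

lemma dsw_ins (w : ℕ → ℕ) (M m p : ℕ) (hp : p ≤ m) (hw : ∀ i, w i < M) :
    dsw (fun i => if i ≤ p then w i else if i = p + 1 then M else w (i - 1)) (m + 2)
      + (if w (p + 1) < w p then 1 else 0) = dsw w (m + 1) + 1 := by
  obtain ⟨q, rfl⟩ := Nat.exists_eq_add_of_le hp
  unfold dsw
  rw [show p + q + 2 = (p + 2) + q by ring, show p + q + 1 = (p + 1) + q by ring,
    Finset.sum_range_add _ (p + 2) q, Finset.sum_range_add _ (p + 1) q,
    Finset.sum_range_succ _ (p + 1), Finset.sum_range_succ _ p, Finset.sum_range_succ _ p]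
  have e1 : ∀ i ∈ Finset.range p, (if (if i + 1 ≤ p then w (i + 1) else if i + 1 = p + 1 then M
      else w (i + 1 - 1)) < (if i ≤ p then w i else if i = p + 1 then M else w (i - 1)) then 1 else 0)
      = if w (i + 1) < w i then 1 else 0 := by
    intro i hi
    rw [Finset.mem_range] at hi
    rw [if_pos (by omega : i + 1 ≤ p), if_pos (by omega : i ≤ p)]
  have e2 : ∀ i ∈ Finset.range q, (if (if p + 2 + i + 1 ≤ p then w (p + 2 + i + 1) else
      if p + 2 + i + 1 = p + 1 then M else w (p + 2 + i + 1 - 1)) <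
      (if p + 2 + i ≤ p then w (p + 2 + i) else if p + 2 + i = p + 1 then M
        else w (p + 2 + i - 1)) then 1 else 0)
      = if w (p + 1 + i + 1) < w (p + 1 + i) then 1 else 0 := by
    intro i hi
    rw [if_neg (by omega : ¬ p + 2 + i + 1 ≤ p), if_neg (by omega : ¬ p + 2 + i ≤ p),
      if_neg (by omega : ¬ p + 2 + i + 1 = p + 1), if_neg (by omega : ¬ p + 2 + i = p + 1)]
    rw [show p + 2 + i + 1 - 1 = p + 1 + i + 1 by omega, show p + 2 + i - 1 = p + 1 + i by omega]
  rw [Finset.sum_congr rfl e1, Finset.sum_congr rfl e2]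
  have h1 := hw p
  have h2 := hw (p + 1)
  have e3 : ¬ (M < w p) := by omega
  simp [e3, h2]
  ring

/-- padded cyclic descents -/
def cdp {m : ℕ} (τ : Equiv.Perm (Fin m)) : ℕ := dsw (wd τ) (m + 1)

lemma cdp_ins {m : ℕ} (p : Fin (m + 1)) (τ : Equiv.Perm (Fin m)) :
    cdp (insMax p τ) = if wd τ (p + 1) < wd τ p then cdp τ else cdp τ + 1 := by
  have h := dsw_ins (wd τ) (m + 1) m p (by have := p.2; omega)
    (fun i => Nat.lt_succ_of_le (wd_le τ i))
  have e : wd (insMax p τ) = (fun i => if i ≤ (p : ℕ) then wd τ i else if i = p + 1 then m + 1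
      else wd τ (i - 1)) := funext (wd_ins p τ)
  rw [← e] at h
  unfold cdp
  split_ifs at h ⊢ <;> simp only [add_assoc, Nat.reduceAdd] at h ⊢ <;> omega

lemma sum_cdp_succ (m : ℕ) (f : ℕ → ℂ) :
    ∑ σ : Equiv.Perm (Fin (m + 1)), f (cdp σ) =
      ∑ τ : Equiv.Perm (Fin m),
        ((cdp τ : ℂ) * f (cdp τ) + ((m : ℂ) + 1 - cdp τ) * f (cdp τ + 1)) := by
  rw [← (insMax_bijective m).sum_comp (fun σ => f (cdp σ)), Fintype.sum_prod_type_right]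
  refine Finset.sum_congr rfl fun τ _ => ?_
  simp only [cdp_ins]
  have e : ∀ p : Fin (m + 1), f (if wd τ (p + 1) < wd τ p then cdp τ else cdp τ + 1)
      = f (cdp τ + 1) + ((if wd τ (p + 1) < wd τ p then 1 else 0 : ℕ) : ℂ) *
        (f (cdp τ) - f (cdp τ + 1)) := by
    intro p
    split_ifs <;> simp
  simp only [e]
  rw [Finset.sum_add_distrib, ← Finset.sum_mul, ← Nat.cast_sum,
    Fin.sum_univ_eq_sum_range (fun i => if wd τ (i + 1) < wd τ i then 1 else 0)]
  change _ + ((cdp τ : ℕ) : ℂ) * _ = _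
  simp
  ring

lemma cdes_eq_cdp {m : ℕ} (τ : Equiv.Perm (Fin m)) :
    cyclicDescents (m + 1) (Equiv.Perm.decomposeFin.symm (0, τ)) = cdp τ := by
  unfold cyclicDescents cdp dsw
  rw [Finset.card_filter, ← Fin.sum_univ_eq_sum_range
    (fun i => if wd τ (i + 1) < wd τ i then 1 else 0)]
  refine Finset.sum_congr rfl fun i _ => ?_
  have h1 : ∀ i : Fin (m + 1),
      ((Equiv.Perm.decomposeFin.symm (0, τ) i : Fin (m + 1)) : ℕ) = wd τ i := by
    intro i
    refine Fin.cases ?_ (fun i => ?_) i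
    · simp [wd]
    · simp [wd]
  have h2 : wd τ (finRotate (m + 1) i) = wd τ (i + 1) := by
    rw [coe_finRotate]
    split_ifs with h
    · subst h; simp [wd]
    · rfl
  simp only [Fin.lt_def, h1, h2]

lemma sum_cdes_fiber (m : ℕ) (f : ℕ → ℕ) :
    ∑ σ : Equiv.Perm (Fin (m + 1)), f (cyclicDescents (m + 1) σ) =
      (m + 1) * ∑ τ : Equiv.Perm (Fin m), f (cdp τ) := by
  rw [← Finset.sum_fiberwise (s := Finset.univ)
    (g := fun σ : Equiv.Perm (Fin (m + 1)) => σ.symm 0)]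
  have key : ∀ k : Fin (m + 1), ∑ σ : Equiv.Perm (Fin (m + 1)) with σ.symm 0 = k,
      f (cyclicDescents (m + 1) σ) = ∑ τ : Equiv.Perm (Fin m), f (cdp τ) := by
    intro k
    symm
    refine Finset.sum_bij (fun τ _ => (Equiv.subRight k).trans
      (Equiv.Perm.decomposeFin.symm (0, τ))) ?_ ?_ ?_ ?_
    · intro τ _
      simp only [Finset.mem_filter, Finset.mem_univ, true_and]
      rw [Equiv.symm_apply_eq]
      simp
    · intro τ _ ρ _ h
      have h' : Equiv.Perm.decomposeFin.symm ((0 : Fin (m+1)), τ) = Equiv.Perm.decomposeFin.symm (0, ρ) := by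
        ext i
        have := congrArg (fun s => s (i + k)) h
        simp at this
        rw [this]
      simpa using h'
    · intro σ hσ
      simp only [Finset.mem_filter, Finset.mem_univ, true_and] at hσ
      refine ⟨(Equiv.Perm.decomposeFin ((Equiv.addRight k).trans σ)).2, Finset.mem_univ _, ?_⟩
      have h0 : (Equiv.Perm.decomposeFin ((Equiv.addRight k).trans σ)).1 = 0 := by
        have := Equiv.Perm.decomposeFin_symm_apply_zero
          (Equiv.Perm.decomposeFin ((Equiv.addRight k).trans σ)).1
          (Equiv.Perm.decomposeFin ((Equiv.addRight k).trans σ)).2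
        rw [← this]
        simp [← hσ]
      rw [← h0]
      ext i
      simp
    · intro τ _
      rw [← cdes_eq_cdp]
      congr 1
      unfold cyclicDescents
      refine Finset.card_equiv (Equiv.addRight k) fun i => ?_
      simp only [Finset.mem_filter, Finset.mem_univ, true_and, finRotate_apply]
      simp [add_sub_right_comm]
  rw [Finset.sum_congr rfl fun k _ => key k]
  simp

lemma circEulerian_eq (m l : ℕ) :
    circEulerian (m + 1) l = (Finset.univ.filter (fun τ : Equiv.Perm (Fin m) => cdp τ = l)).card := by
  have := sum_cdes_fiber m (fun j => if j = l then 1 else 0)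
  rw [← Finset.card_filter, ← Finset.card_filter] at this
  unfold circEulerian
  rw [this]
  simp

lemma circEulerian_symm (m l : ℕ) (hl : l ≤ m + 2) :
    circEulerian (m + 2) (m + 2 - l) = circEulerian (m + 2) l := by
  unfold circEulerian
  congr 1
  refine Finset.card_equiv (Equiv.mulLeft Fin.revPerm) fun σ => ?_
  simp only [Finset.mem_filter, Finset.mem_univ, true_and]
  have : cyclicDescents (m + 2) (Equiv.mulLeft Fin.revPerm σ) + cyclicDescents (m + 2) σ
      = m + 2 := by
    unfold cyclicDescents
    have h := Finset.card_filter_add_card_filter_not (s := (Finset.univ : Finset (Fin (m + 2))))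
      (fun i => σ (finRotate (m + 2) i) < σ i)
    rw [Finset.card_univ, Fintype.card_fin, add_comm] at h
    refine Eq.trans ?_ h
    congr 2
    ext i
    have hne : σ (finRotate (m + 2) i) ≠ σ i := by
      rw [finRotate_apply]; simp
    simp [lt_iff_le_and_ne]
  omega

lemma cdp_le {m : ℕ} (τ : Equiv.Perm (Fin m)) : cdp τ ≤ m + 1 := by
  unfold cdp dsw
  refine (Finset.sum_le_card_nsmul _ _ 1 fun i _ => by split_ifs <;> simp).trans (by simp)

lemma sum_cdp_eq (m : ℕ) (f : ℕ → ℂ) :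
    ∑ τ : Equiv.Perm (Fin m), f (cdp τ) =
      ∑ l ∈ Finset.range (m + 2), (circEulerian (m + 1) l : ℂ) * f l := by
  rw [← Finset.sum_fiberwise_of_maps_to (s := Finset.univ) (t := Finset.range (m + 2))
    (g := fun τ : Equiv.Perm (Fin m) => cdp τ)
    (fun τ _ => Finset.mem_range.2 (Nat.lt_succ_of_le (cdp_le τ)))]
  refine Finset.sum_congr rfl fun l _ => ?_
  rw [Finset.sum_congr rfl (g := fun _ => f l) (fun τ hτ => by rw [(Finset.mem_filter.1 hτ).2])]
  simp [circEulerian_eq]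

lemma circEulerian_zero (m : ℕ) : circEulerian (m + 2) 0 = 0 := by
  unfold circEulerian
  rw [Nat.div_eq_zero_iff]
  right
  rw [Finset.card_eq_zero.2]
  · omega
  · rw [Finset.filter_eq_empty_iff]
    intro σ _ h
    unfold cyclicDescents at h
    rw [Finset.card_eq_zero, Finset.filter_eq_empty_iff] at h
    have := h (Finset.mem_univ (σ.symm (Fin.last _)))
    rw [finRotate_apply] at this
    simp only [Equiv.apply_symm_apply, not_lt, Fin.last_le_iff] at this
    rw [← Equiv.eq_symm_apply] at this
    simp at this

section cheb
lemma cheb_choose (k i : ℕ) :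
    (k + 2 + (i + 1)).choose (2 * (i + 1)) + (k + (i + 1)).choose (2 * (i + 1)) =
      2 * (k + 1 + (i + 1)).choose (2 * (i + 1)) + (k + 1 + i).choose (2 * i) := by
  rw [show k + 2 + (i + 1) = k + i + 1 + 1 + 1 by ring, show 2 * (i + 1) = 2 * i + 1 + 1 by ring,
    show k + (i + 1) = k + i + 1 by ring, show k + 1 + (i + 1) = k + i + 1 + 1 by ring,
    show k + 1 + i = k + i + 1 by ring]
  rw [Nat.choose_succ_succ (k + i + 1 + 1), Nat.choose_succ_succ (k + i + 1) (2 * i + 1),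
    Nat.choose_succ_succ (k + i + 1) (2 * i)]
  ring

/-- the polynomial `∑ (-4)^i C(k+i,2i) x^i` -/
def chebV (k : ℕ) (x : ℂ) : ℂ :=
  ∑ i ∈ Finset.range (k + 1), (-4 : ℂ) ^ i * ((k + i).choose (2 * i) : ℂ) * x ^ i

lemma chebV_ext (k M : ℕ) (h : k + 1 ≤ M) (x : ℂ) :
    chebV k x = ∑ i ∈ Finset.range M, (-4 : ℂ) ^ i * ((k + i).choose (2 * i) : ℂ) * x ^ i := by
  unfold chebV
  refine Finset.sum_subset (Finset.range_mono h) fun i _ hi => ?_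
  rw [Finset.mem_range] at hi
  rw [Nat.choose_eq_zero_of_lt (by omega)]
  simp

lemma chebV_rec (k : ℕ) (x : ℂ) :
    chebV (k + 2) x = (2 - 4 * x) * chebV (k + 1) x - chebV k x := by
  have h1 : (4 * x) * chebV (k + 1) x = - ∑ i ∈ Finset.range (k + 2),
      (-4 : ℂ) ^ (i + 1) * ((k + 1 + i).choose (2 * i) : ℂ) * x ^ (i + 1) := by
    unfold chebV
    rw [Finset.mul_sum, ← Finset.sum_neg_distrib]
    refine Finset.sum_congr rfl fun i _ => by ring
  rw [sub_mul, h1, chebV_ext (k + 1) (k + 3) (by omega), chebV_ext k (k + 3) (by omega)]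
  unfold chebV
  rw [Finset.sum_range_succ' _ (k + 2), Finset.sum_range_succ' _ (k + 2),
    Finset.sum_range_succ' _ (k + 2)]
  have : ∀ i, ((k + 2 + (i + 1)).choose (2 * (i + 1)) : ℂ) =
      2 * (k + 1 + (i + 1)).choose (2 * (i + 1)) + (k + 1 + i).choose (2 * i)
      - (k + (i + 1)).choose (2 * (i + 1)) := by
    intro i
    rw [eq_sub_iff_add_eq]
    exact_mod_cast cheb_choose k i
  simp only [this]
  have e : ∀ i ∈ Finset.range (k + 2), (-4 : ℂ) ^ (i + 1) *
      (2 * (k + 1 + (i + 1)).choose (2 * (i + 1)) + (k + 1 + i).choose (2 * i)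
      - (k + (i + 1)).choose (2 * (i + 1))) * x ^ (i + 1) =
      2 * ((-4 : ℂ) ^ (i + 1) * ((k + 1 + (i + 1)).choose (2 * (i + 1)) : ℂ) * x ^ (i + 1))
      + (-4 : ℂ) ^ (i + 1) * ((k + 1 + i).choose (2 * i) : ℂ) * x ^ (i + 1)
      - (-4 : ℂ) ^ (i + 1) * ((k + (i + 1)).choose (2 * (i + 1)) : ℂ) * x ^ (i + 1) :=
    fun i _ => by ring
  rw [Finset.sum_congr rfl e, Finset.sum_sub_distrib, Finset.sum_add_distrib, ← Finset.mul_sum]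
  simp
  ring

lemma cos_odd (k : ℕ) (y : ℂ) :
    Complex.cos ((2 * k + 1) * y) = Complex.cos y * chebV k (Complex.sin y ^ 2) := by
  induction k using Nat.twoStepInduction with
  | zero => simp [chebV]
  | one =>
    simp [chebV, Finset.sum_range_succ]
    rw [show (2 + 1 : ℂ) * y = 3 * y by ring, Complex.cos_three_mul]
    have := Complex.sin_sq_add_cos_sq y
    linear_combination (4 * Complex.cos y) * this
  | more k h1 h2 =>
    rw [chebV_rec]
    have e : Complex.cos ((2 * ((k + 2 : ℕ) : ℂ) + 1) * y) =
      2 * Complex.cos (2 * y) * Complex.cos ((2 * ((k + 1 : ℕ) : ℂ) + 1) * y)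
        - Complex.cos ((2 * (k : ℂ) + 1) * y) := by
      push_cast
      rw [show (2 * ((k : ℂ) + 2) + 1) * y = (2 * ((k : ℂ) + 1) + 1) * y + 2 * y by ring,
        show (2 * (k : ℂ) + 1) * y = (2 * ((k : ℂ) + 1) + 1) * y - 2 * y by ring,
        Complex.cos_add, Complex.cos_sub]
      ring
    rw [e, h1, h2, Complex.cos_two_mul, Complex.cos_sq']
    ring

lemma uCoeff_sum (k : ℕ) (y : ℂ) :
    Complex.cos ((2 * k + 1) * y) = Complex.cos y *
      ((-1) ^ k * ∑ i ∈ Finset.range (k + 1), (uCoeff k i : ℂ) * Complex.sin y ^ (2 * i)) := by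
  rw [cos_odd]
  unfold chebV uCoeff
  congr 1
  rw [Finset.mul_sum]
  refine Finset.sum_congr rfl fun i hi => ?_
  rw [Finset.mem_range] at hi
  obtain ⟨j, rfl⟩ := Nat.exists_eq_add_of_le (show i ≤ k by omega)
  have h1 : (i + j + i).choose (i + j - i) = (i + j + i).choose (2 * i) := by
    rw [← Nat.choose_symm_of_eq_add]; omega
  rw [h1]
  push_cast
  rw [show i + j - i = j by omega, ← pow_mul, pow_mul 2 2 i, pow_add]
  have : (-4 : ℂ) ^ i = (-1) ^ i * 4 ^ i := by rw [← mul_pow]; norm_num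
  rw [this]
  have h2 : ((-1 : ℂ) ^ j) * (-1) ^ j = 1 := by rw [← mul_pow]; simp
  norm_num
  linear_combination (-(-1 : ℂ) ^ i * 4 ^ i * (i + j + i).choose (2 * i) *
    Complex.sin y ^ (2 * i)) * h2
end cheb

section analysis
open Complex in
/-- Eulerian trigonometric polynomial -/
noncomputable def PP (m : ℕ) (y : ℂ) : ℂ :=
  ∑ τ : Equiv.Perm (Fin m), Complex.exp (Complex.I * (2 * (cdp τ : ℂ) - m - 1) * y)

lemma PP_deriv (m : ℕ) (y : ℂ) : HasDerivAt (PP m)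
    (∑ τ : Equiv.Perm (Fin m), Complex.exp (Complex.I * (2 * (cdp τ : ℂ) - m - 1) * y) *
      (Complex.I * (2 * (cdp τ : ℂ) - m - 1))) y := by
  unfold PP
  apply HasDerivAt.fun_sum
  intro τ _
  refine HasDerivAt.cexp ?_
  simpa using (hasDerivAt_id y).const_mul (Complex.I * (2 * (cdp τ : ℂ) - m - 1))

lemma PP_rec (m : ℕ) (y : ℂ) :
    (∑ τ : Equiv.Perm (Fin m), Complex.exp (Complex.I * (2 * (cdp τ : ℂ) - m - 1) * y) *
      (Complex.I * (2 * (cdp τ : ℂ) - m - 1))) * Complex.sin y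
      - (m + 1) * PP m y * Complex.cos y = - PP (m + 1) y := by
  have h := sum_cdp_succ m (fun l => Complex.exp (Complex.I * (2 * (l : ℂ) - (m + 1 : ℕ) - 1) * y))
  have h' : PP (m + 1) y = _ := h
  rw [h']
  unfold PP
  rw [Finset.sum_mul, Finset.mul_sum, Finset.sum_mul, ← Finset.sum_sub_distrib,
    ← Finset.sum_neg_distrib]
  refine Finset.sum_congr rfl fun τ _ => ?_
  rw [Complex.sin, Complex.cos]
  push_cast
  rw [show Complex.I * (2 * (cdp τ : ℂ) - (m + 1) - 1) * y =
      Complex.I * (2 * (cdp τ : ℂ) - m - 1) * y + (-y * Complex.I) by ring,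
    show Complex.I * (2 * ((cdp τ : ℂ) + 1) - (m + 1) - 1) * y =
      Complex.I * (2 * (cdp τ : ℂ) - m - 1) * y + (y * Complex.I) by ring,
    Complex.exp_add, Complex.exp_add]
  set E := Complex.exp (Complex.I * (2 * (cdp τ : ℂ) - m - 1) * y)
  set A := Complex.exp (y * Complex.I)
  set B := Complex.exp (-y * Complex.I)
  linear_combination (E * (2 * (cdp τ : ℂ) - m - 1) * (B - A) / 2) * Complex.I_sq

lemma PP_quot_deriv (m : ℕ) (y : ℂ) (hy : Complex.sin y ≠ 0) :
    HasDerivAt (fun y => PP m y / Complex.sin y ^ (m + 1))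
      (- PP (m + 1) y / Complex.sin y ^ (m + 2)) y := by
  have h := (PP_deriv m y).div ((Complex.hasDerivAt_sin y).pow (m + 1)) (pow_ne_zero _ hy)
  convert! h using 1
  rw [← PP_rec]
  simp only [Pi.pow_apply, Nat.add_sub_cancel]
  generalize (∑ τ : Equiv.Perm (Fin m), Complex.exp (Complex.I * (2 * (cdp τ : ℂ) - m - 1) * y) *
      (Complex.I * (2 * (cdp τ : ℂ) - m - 1))) = S
  field_simp
  push_cast
  ring

lemma PP_zero (y : ℂ) (hy : Complex.sin y ≠ 0) :
    Complex.cot y = PP 0 y / Complex.sin y ^ (0 + 1) + Complex.I := by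
  have : ∀ τ : Equiv.Perm (Fin 0), cdp τ = 0 := by
    intro τ; simp [cdp, dsw, wd]
  unfold PP
  simp only [this]
  rw [Complex.cot]
  field_simp
  have : Complex.exp (-(Complex.I * y)) = Complex.cos y - Complex.sin y * Complex.I := by
    rw [show -(Complex.I * y) = (-y) * Complex.I by ring, Complex.exp_mul_I]
    simp; ring
  simp [this]
  ring

open UpperHalfPlane in
lemma iter_cot (m : ℕ) : Set.EqOn
    (iteratedDerivWithin (m + 1) (fun x : ℂ ↦ π * Complex.cot (π * x)) upperHalfPlaneSet)
    (fun z => (-1) ^ (m + 1) * π ^ (m + 2) *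
      (PP (m + 1) (π * z) / Complex.sin (π * z) ^ (m + 2))) upperHalfPlaneSet := by
  have hs : ∀ z ∈ upperHalfPlaneSet, Complex.sin (π * z) ≠ 0 := fun z hz =>
    sin_pi_mul_ne_zero (UpperHalfPlane.coe_mem_integerComplement ⟨z, hz⟩)
  have hd : ∀ k : ℕ, ∀ z ∈ upperHalfPlaneSet, HasDerivAt (fun z : ℂ =>
      PP k (π * z) / Complex.sin (π * z) ^ (k + 1))
      (- PP (k + 1) (π * z) / Complex.sin (π * z) ^ (k + 2) * π) z := by
    intro k z hz
    have h1 : HasDerivAt (fun z : ℂ => (π : ℂ) * z) π z := by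
      simpa using (hasDerivAt_id z).const_mul (π : ℂ)
    exact (PP_quot_deriv k (π * z) (hs z hz)).comp z h1
  induction m with
  | zero =>
    intro z hz
    rw [zero_add, iteratedDerivWithin_one, derivWithin_congr (f := fun z : ℂ => π *
      (PP 0 (π * z) / Complex.sin (π * z) ^ (0 + 1) + Complex.I))
      (fun x hx => by simp only; rw [PP_zero _ (hs x hx)]) (by rw [PP_zero _ (hs z hz)]),
      derivWithin_of_isOpen isOpen_upperHalfPlaneSet hz]
    rw [(((hd 0 z hz).add_const Complex.I).const_mul (π : ℂ)).deriv]
    ring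
  | succ m ih =>
    intro z hz
    rw [iteratedDerivWithin_succ, derivWithin_congr ih (ih hz),
      derivWithin_of_isOpen isOpen_upperHalfPlaneSet hz]
    rw [((hd (m + 1) z hz).const_mul _).deriv]
    ring

lemma sum_real (m : ℕ) (a : ℝ) (ha : ∀ k : ℤ, a + k ≠ 0) :
    ((m + 1).factorial : ℂ) * ∑' k : ℤ, 1 / ((a : ℂ) + k) ^ (m + 2) =
      π ^ (m + 2) * (PP (m + 1) (π * a) / Complex.sin (π * a) ^ (m + 2)) := by
  have hup : ∀ t : ℝ, 0 < t → ((m + 1).factorial : ℂ) *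
      ∑' k : ℤ, 1 / (((a : ℂ) + t * Complex.I) + k) ^ (m + 2) =
      π ^ (m + 2) * (PP (m + 1) (π * (a + t * Complex.I)) /
        Complex.sin (π * (a + t * Complex.I)) ^ (m + 2)) := by
    intro t ht
    have hz : (a : ℂ) + t * Complex.I ∈ UpperHalfPlane.upperHalfPlaneSet := by
      simpa [UpperHalfPlane.upperHalfPlaneSet] using ht
    have h1 := iteratedDerivWithin_cot_pi_mul_eq_mul_tsum_div_pow (k := m + 1) (by omega) hz
    rw [iter_cot m hz] at h1
    have h2 : ((-1 : ℂ) ^ (m + 1)) * (-1) ^ (m + 1) = 1 := by rw [← mul_pow]; simp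
    simp only at h1
    linear_combination (-(-1 : ℂ) ^ (m + 1)) * h1 + (-((m + 1).factorial : ℂ) *
      ∑' k : ℤ, 1 / (((a : ℂ) + t * Complex.I) + k) ^ (m + 2) + π ^ (m + 2) * (PP (m + 1) (π * (a + t * Complex.I)) /
        Complex.sin (π * (a + t * Complex.I)) ^ (m + 2))) * h2
  have hsin : Complex.sin (π * a) ≠ 0 := by
    apply sin_pi_mul_ne_zero
    rintro ⟨k, hk⟩
    apply ha (-k)
    have : (k : ℝ) = a := by exact_mod_cast hk
    rw [← this]; simp
  have hR : Tendsto (fun t : ℝ => (π : ℂ) ^ (m + 2) * (PP (m + 1) (π * (a + t * Complex.I)) /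
        Complex.sin (π * (a + t * Complex.I)) ^ (m + 2))) (nhdsWithin 0 (Set.Ioi 0))
      (nhds (π ^ (m + 2) * (PP (m + 1) (π * a) / Complex.sin (π * a) ^ (m + 2)))) := by
    have hc : ContinuousAt (fun t : ℝ => (π : ℂ) ^ (m + 2) * (PP (m + 1) (π * (a + t * Complex.I)) /
        Complex.sin (π * (a + t * Complex.I)) ^ (m + 2))) 0 := by
      have hP : Continuous (PP (m + 1)) := by unfold PP; fun_prop
      refine ContinuousAt.mul continuousAt_const (ContinuousAt.div ?_ ?_ ?_)
      · exact (hP.comp (by fun_prop : Continuous fun t : ℝ => (π : ℂ) * (a + t * Complex.I))).continuousAt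
      · fun_prop
      · simpa using hsin
    have := hc.tendsto.mono_left (nhdsWithin_le_nhds (s := Set.Ioi 0))
    simpa using this
  have hsum : Summable (fun k : ℤ => 1 / |(k : ℝ) + a| ^ (m + 2)) := by
    have := (Real.summable_one_div_int_add_rpow a (m + 2 : ℕ)).2 (by push_cast; linarith)
    simpa only [Real.rpow_natCast] using this
  have hL : Tendsto (fun t : ℝ => ((m + 1).factorial : ℂ) *
      ∑' k : ℤ, 1 / (((a : ℂ) + t * Complex.I) + k) ^ (m + 2)) (nhdsWithin 0 (Set.Ioi 0))
      (nhds (((m + 1).factorial : ℂ) * ∑' k : ℤ, 1 / ((a : ℂ) + k) ^ (m + 2))) := by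
    refine Tendsto.const_mul _ (tendsto_tsum_of_dominated_convergence hsum ?_ ?_)
    · intro k
      have hc : ContinuousAt (fun t : ℝ => 1 / (((a : ℂ) + t * Complex.I) + k) ^ (m + 2)) 0 := by
        refine ContinuousAt.div continuousAt_const (by fun_prop) ?_
        apply pow_ne_zero
        have := ha k
        simp
        exact_mod_cast this
      have := hc.tendsto.mono_left (nhdsWithin_le_nhds (s := Set.Ioi 0))
      simpa using this
    · refine Eventually.of_forall fun t k => ?_
      rw [norm_div, norm_one, norm_pow]
      have hpos : 0 < |(k : ℝ) + a| := abs_pos.2 (by rw [add_comm]; exact ha k)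
      have hle : |(k : ℝ) + a| ≤ ‖((a : ℂ) + t * Complex.I) + k‖ := by
        have := Complex.abs_re_le_norm (((a : ℂ) + t * Complex.I) + k)
        simpa [add_comm] using this
      gcongr
  refine tendsto_nhds_unique hL (hR.congr' ?_)
  filter_upwards [self_mem_nhdsWithin] with t ht
  exact (hup t ht).symm
end analysis

lemma PP_even (n : ℕ) (hn : 1 ≤ n) (y : ℂ) :
    PP (2 * n) y = 2 * ∑ l ∈ Finset.Icc 1 n,
      (circEulerian (2 * n + 1) l : ℂ) * Complex.cos ((2 * (n - l : ℕ) + 1) * y) := by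
  have h := sum_cdp_eq (2 * n)
    (fun l => Complex.exp (Complex.I * (2 * (l : ℂ) - (2 * n : ℕ) - 1) * y))
  have h' : PP (2 * n) y = _ := h
  rw [h', show 2 * n + 2 = (n + 1) + (n + 1) by ring, Finset.sum_range_add,
    ← Finset.sum_range_reflect (fun j => (circEulerian (2 * n + 1) (n + 1 + j) : ℂ) * _),
    ← Finset.sum_add_distrib, Finset.mul_sum, Finset.range_eq_Ico,
    Finset.sum_eq_sum_Ico_succ_bot (by omega)]
  obtain ⟨k, rfl⟩ : ∃ k, n = k + 1 := ⟨n - 1, by omega⟩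
  have z1 : circEulerian (2 * (k + 1) + 1) 0 = 0 := circEulerian_zero (2 * k + 1)
  have sy : ∀ l, l ≤ k + 1 → circEulerian (2 * (k + 1) + 1) (k + 1 + 1 + (k + 1 + 1 - 1 - l)) =
      circEulerian (2 * (k + 1) + 1) l := by
    intro l hl
    refine Eq.trans ?_ (circEulerian_symm (2 * k + 1) l (by omega))
    congr 1
    omega
  rw [sy 0 (by omega), z1]
  simp only [Nat.cast_zero, zero_mul, zero_add]
  refine Finset.sum_congr rfl fun l hl => ?_
  have hl' : l ≤ k + 1 := by
    have := (Finset.mem_Ico.1 hl).2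
    omega
  rw [sy l hl', Complex.cos]
  obtain ⟨j, hj⟩ := Nat.exists_eq_add_of_le hl'
  have e1 : k + 1 - l = j := by omega
  have e2 : k + 1 + 1 + (k + 1 + 1 - 1 - l) = k + 2 + j := by omega
  have e3 : (l : ℂ) = k + 1 - j := by
    rw [eq_sub_iff_add_eq]; exact_mod_cast hj.symm
  rw [e1, e2, e3]
  push_cast
  rw [show Complex.I * (2 * ((k : ℂ) + 1 - j) - 2 * (k + 1) - 1) * y =
      -((2 * j + 1) * y) * Complex.I by ring,
    show Complex.I * (2 * ((k : ℂ) + 2 + j) - 2 * (k + 1) - 1) * y =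
      ((2 * j + 1) * y) * Complex.I by ring]
  ring

lemma PP_bCoeff (n : ℕ) (hn : 1 ≤ n) (y : ℂ) (hy : Complex.sin y ≠ 0) :
    PP (2 * n) y / Complex.sin y ^ (2 * n + 1) = 2 * ∑ i ∈ Finset.Icc 1 n,
      (bCoeff n i : ℂ) * (Complex.cot y / Complex.sin y ^ (2 * i)) := by
  rw [PP_even n hn, mul_div_assoc]
  congr 1
  rw [Finset.sum_div]
  have e1 : ∀ l ∈ Finset.Icc 1 n, (circEulerian (2 * n + 1) l : ℂ) *
      Complex.cos ((2 * (n - l : ℕ) + 1) * y) / Complex.sin y ^ (2 * n + 1) =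
      ∑ i ∈ Finset.Icc l n, ((-1) ^ (n - l) * (uCoeff (n - l) (n - i) : ℂ) *
        (circEulerian (2 * n + 1) l : ℂ)) * (Complex.cot y / Complex.sin y ^ (2 * i)) := by
    intro l hl
    rw [Finset.mem_Icc] at hl
    rw [uCoeff_sum]
    have e2 : ∑ i ∈ Finset.range (n - l + 1), (uCoeff (n - l) i : ℂ) * Complex.sin y ^ (2 * i) =
        ∑ i ∈ Finset.Icc l n, (uCoeff (n - l) (n - i) : ℂ) * Complex.sin y ^ (2 * (n - i)) := by
      refine Finset.sum_bij' (fun i _ => n - i) (fun i _ => n - i) ?_ ?_ ?_ ?_ ?_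
      · intro i hi; simp only [Finset.mem_range, Finset.mem_Icc] at *; omega
      · intro i hi; simp only [Finset.mem_range, Finset.mem_Icc] at *; omega
      · intro i hi; simp only [Finset.mem_range] at *; omega
      · intro i hi; simp only [Finset.mem_Icc] at *; omega
      · intro i hi; simp only [Finset.mem_range] at hi
        rw [show n - (n - i) = i by omega]
    rw [e2, Finset.mul_sum, Finset.mul_sum, Finset.mul_sum, Finset.sum_div]
    refine Finset.sum_congr rfl fun i hi => ?_
    rw [Finset.mem_Icc] at hi
    obtain ⟨j, hj⟩ := Nat.exists_eq_add_of_le hi.2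
    rw [Complex.cot, show n - i = j by omega,
      show Complex.sin y ^ (2 * n + 1) = Complex.sin y ^ (2 * i) * Complex.sin y ^ (2 * j) *
        Complex.sin y by rw [← pow_add, ← pow_succ, hj, mul_add]]
    field_simp
  rw [Finset.sum_congr rfl e1]
  unfold bCoeff
  push_cast
  simp only [Finset.sum_mul]
  refine Finset.sum_comm' ?_
  intro l i
  simp only [Finset.mem_Icc]
  omega

lemma hurwitz_val (n : ℕ) (hn : 1 ≤ n) (a : ℝ) (ha : ∀ k : ℤ, a + k ≠ 0) :
    HurwitzZeta.hurwitzZetaOdd (a : UnitAddCircle) ((2 * n + 1 : ℕ) : ℂ) =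
      (π : ℂ) ^ (2 * n + 1) / ((2 * n).factorial : ℂ) * ∑ i ∈ Finset.Icc 1 n,
      (bCoeff n i : ℂ) * (Complex.cot (π * a) / Complex.sin (π * a) ^ (2 * i)) := by
  have h := HurwitzZeta.hasSum_int_hurwitzZetaOdd a (s := ((2 * n + 1 : ℕ) : ℂ))
    (by rw [Complex.natCast_re]; exact_mod_cast (by omega : 1 < 2 * n + 1))
  rw [← h.tsum_eq]
  have e : ∀ k : ℤ, ((SignType.sign ((k : ℝ) + a) : ℝ) : ℂ) / ((|(k : ℝ) + a| : ℝ) : ℂ) ^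
      ((2 * n + 1 : ℕ) : ℂ) / 2 = 1 / ((a : ℂ) + k) ^ (2 * n + 1) / 2 := by
    intro k
    have hk : (k : ℝ) + a ≠ 0 := by rw [add_comm]; exact ha k
    rw [Complex.cpow_natCast, add_comm (a : ℂ)]
    congr 1
    have : ((SignType.sign ((k : ℝ) + a) : ℝ)) / (|(k : ℝ) + a|) ^ (2 * n + 1) =
        1 / ((k : ℝ) + a) ^ (2 * n + 1) := by
      rcases lt_or_gt_of_ne hk with h | h
      · rw [sign_neg h, abs_of_neg h, Odd.neg_pow ⟨n, rfl⟩]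
        simp
      · rw [sign_pos h, abs_of_pos h]
        simp
    exact_mod_cast congrArg (fun x : ℝ => (x : ℂ)) this
  have e' : (∑' k : ℤ, ((SignType.sign ((k : ℝ) + a) : ℝ) : ℂ) / ((|(k : ℝ) + a| : ℝ) : ℂ) ^
      ((2 * n + 1 : ℕ) : ℂ) / 2) = ∑' k : ℤ, 1 / ((a : ℂ) + k) ^ (2 * n + 1) / 2 :=
    tsum_congr e
  have hsin : Complex.sin (π * a) ≠ 0 := by
    apply sin_pi_mul_ne_zero
    rintro ⟨k, hk⟩
    apply ha (-k)
    have : (k : ℝ) = a := by exact_mod_cast hk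
    rw [← this]; simp
  have hS := sum_real (2 * n - 1) a ha
  rw [show 2 * n - 1 + 2 = 2 * n + 1 by omega, show 2 * n - 1 + 1 = 2 * n by omega,
    PP_bCoeff n hn _ hsin] at hS
  have hf : ((2 * n).factorial : ℂ) ≠ 0 := by exact_mod_cast Nat.factorial_ne_zero _
  refine Eq.trans (b := ∑' k : ℤ, 1 / ((a : ℂ) + k) ^ (2 * n + 1) / 2) ?_ ?_
  · rw [← e']
    refine tsum_congr fun k => ?_
    congr 2
    cases SignType.sign ((k : ℝ) + a) <;> simp
  · rw [tsum_div_const, div_mul_eq_mul_div, eq_div_iff hf]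
    linear_combination hS / 2

/-- For an odd Dirichlet character `χ` mod `N` (`N > 2`) and `n ≥ 1`,
`L(2n+1,χ) = (π^{2n+1} / ((2n)! N^{2n+1})) ∑_{i=1}^{n} b_{n,i} L̃_{ℤ/Nℤ}(i,χ)`, where
`L̃_{ℤ/Nℤ}(i,χ) = ∑_{m=1}^{N-1} χ(m) cot(mπ/N)/sin^{2i}(mπ/N)`. -/
theorem LFunction_odd_eq_graph_LFunction_sum (N : ℕ) [NeZero N] (hN : 2 < N)
    (χ : DirichletCharacter ℂ N) (hodd : χ (-1) = -1) (n : ℕ) (hn : 1 ≤ n) :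
    DirichletCharacter.LFunction χ ((2 * n + 1 : ℕ) : ℂ) =
      ((π : ℂ) ^ (2 * n + 1) / ((Nat.factorial (2 * n) : ℂ) * (N : ℂ) ^ (2 * n + 1))) *
        ∑ i ∈ Finset.Icc 1 n, (bCoeff n i : ℂ) *
          ∑ m ∈ Finset.Icc 1 (N - 1),
            χ (m : ZMod N) * ((Real.cot ((m : ℝ) * π / N) : ℂ)) /
              ((Real.sin ((m : ℝ) * π / N) : ℂ)) ^ (2 * i) := by
  have hN0 : (N : ℂ) ≠ 0 := by exact_mod_cast (by omega : N ≠ 0)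
  have : Fact (1 < N) := ⟨by omega⟩
  have hΦ : Function.Odd (χ : ZMod N → ℂ) := by
    intro x
    rw [show -x = (-1) * x by ring, map_mul, hodd]
    ring
  have hL : DirichletCharacter.LFunction χ ((2 * n + 1 : ℕ) : ℂ) =
    ZMod.LFunction χ ((2 * n + 1 : ℕ) : ℂ) := rfl
  rw [hL, ZMod.LFunction_def_odd hΦ]
  set g : ℕ → ℂ := fun m => χ (m : ZMod N) *
    ((π : ℂ) ^ (2 * n + 1) / ((2 * n).factorial : ℂ) * ∑ i ∈ Finset.Icc 1 n,
      (bCoeff n i : ℂ) * (Complex.cot (π * ((m / N : ℝ) : ℂ)) /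
        Complex.sin (π * ((m / N : ℝ) : ℂ)) ^ (2 * i))) with hg
  have hsum : ∑ j : ZMod N, χ j * HurwitzZeta.hurwitzZetaOdd (ZMod.toAddCircle j)
      ((2 * n + 1 : ℕ) : ℂ) = ∑ m ∈ Finset.Icc 1 (N - 1), g m := by
    rw [← Finset.sum_erase_add _ _ (Finset.mem_univ (0 : ZMod N))]
    rw [MulChar.map_nonunit χ (not_isUnit_zero), zero_mul, add_zero]
    refine Finset.sum_bij' (fun j _ => j.val) (fun m _ => (m : ZMod N)) ?_ ?_ ?_ ?_ ?_
    · intro j hj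
      have h1 := ZMod.val_lt j
      have h2 : j.val ≠ 0 := by
        rw [Ne, ZMod.val_eq_zero]
        exact (Finset.mem_erase.1 hj).1
      rw [Finset.mem_Icc]; omega
    · intro m hm
      rw [Finset.mem_Icc] at hm
      rw [Finset.mem_erase]
      refine ⟨?_, Finset.mem_univ _⟩
      rw [Ne, ZMod.natCast_eq_zero_iff]
      intro hd
      have := Nat.le_of_dvd (by omega) hd
      omega
    · intro j hj
      exact ZMod.natCast_zmod_val j
    · intro m hm
      rw [Finset.mem_Icc] at hm
      exact ZMod.val_cast_of_lt (by omega)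
    · intro j hj
      have h1 := ZMod.val_lt j
      have h2 : j.val ≠ 0 := by
        rw [Ne, ZMod.val_eq_zero]
        exact (Finset.mem_erase.1 hj).1
      rw [hg]
      simp only
      rw [ZMod.natCast_zmod_val, ZMod.toAddCircle_apply, hurwitz_val n hn]
      intro k hk
      have hNR : (N : ℝ) ≠ 0 := by exact_mod_cast (by omega : N ≠ 0)
      have h3 : (j.val : ℝ) + k * N = 0 := by
        field_simp at hk
        linarith
      have h4 : (j.val : ℤ) + k * N = 0 := by exact_mod_cast h3
      have h5 : (N : ℤ) ∣ (j.val : ℤ) := ⟨-k, by linear_combination h4⟩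
      have h6 := Nat.le_of_dvd (by omega) (Int.natCast_dvd_natCast.1 h5)
      omega
  rw [hsum, Complex.cpow_neg, Complex.cpow_natCast, hg]
  simp only [Finset.mul_sum]
  rw [Finset.sum_comm]
  refine Finset.sum_congr rfl fun i _ => Finset.sum_congr rfl fun m _ => ?_
  rw [Complex.ofReal_cot, Complex.ofReal_sin]
  push_cast
  rw [show (π : ℂ) * ((m : ℂ) / N) = m * π / N by ring]
  ring
end

section
/- For all integers N ≥ 2 and n ≥ 1, (N^{2n} − 1) · ζ(2n) = (π^{2n} / (2(2n−1)!)) · ∑_{i=1}^{n} a_{n,i} · ζ_{ℤ/Nℤ}(i), where ζ is the Riemann zeta function. -/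
open Finset Filter Real

lemma cdes_eq (n : ℕ) (σ : Equiv.Perm (Fin (n+1))) :
    cyclicDescents (n+1) σ = ∑ i : Fin (n+1), if σ (i+1) < σ i then 1 else 0 := by
  rw [cyclicDescents, Finset.card_filter]
  simp only [finRotate_apply]

lemma cdes_rot (n : ℕ) (σ : Equiv.Perm (Fin (n+1))) (j : Fin (n+1)) :
    cyclicDescents (n+1) (σ * Equiv.addRight j) = cyclicDescents (n+1) σ := by
  rw [cdes_eq, cdes_eq]
  refine Fintype.sum_equiv (Equiv.addRight j) _ _ ?_
  intro i
  change (if σ (i+1+j) < σ (i+j) then 1 else 0) = if σ (i+j+1) < σ (i+j) then 1 else 0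
  rw [add_right_comm]

lemma sum_rot {R : Type*} [CommRing R] (n : ℕ) (f : ℕ → R) :
    ∑ σ : Equiv.Perm (Fin (n+1)), f (cyclicDescents (n+1) σ) =
      ((n:R)+1) * ∑ σ : Equiv.Perm (Fin (n+1)),
        if σ 0 = 0 then f (cyclicDescents (n+1) σ) else 0 := by
  have h1 : ∀ σ : Equiv.Perm (Fin (n+1)), f (cyclicDescents (n+1) σ) =
      ∑ j : Fin (n+1), if σ j = 0 then f (cyclicDescents (n+1) σ) else 0 := by
    intro σ
    rw [Fintype.sum_equiv σ _ (fun k => if k = 0 then f (cyclicDescents (n+1) σ) else 0)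
      (fun i => rfl)]
    simp
  rw [Finset.sum_congr rfl (fun σ _ => h1 σ), Finset.sum_comm]
  have h2 : ∀ j : Fin (n+1), (∑ σ : Equiv.Perm (Fin (n+1)),
      if σ j = 0 then f (cyclicDescents (n+1) σ) else 0) = ∑ σ : Equiv.Perm (Fin (n+1)),
        if σ 0 = 0 then f (cyclicDescents (n+1) σ) else 0 := by
    intro j
    refine Fintype.sum_equiv (Equiv.mulRight (Equiv.addRight j)) _ _ ?_
    intro σ
    simp [cdes_rot]
  rw [Finset.sum_congr rfl (fun j _ => h2 j)]
  simp

lemma sum_gap {R : Type*} [CommRing R] (n : ℕ) (f : ℕ → R) :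
    ((n:R)+1) * ∑ σ : Equiv.Perm (Fin (n+1)),
        f (cyclicDescents (n+1) σ + if σ 0 < σ (Fin.last n) then 0 else 1) =
    ∑ σ : Equiv.Perm (Fin (n+1)),
      ((cyclicDescents (n+1) σ : R) * f (cyclicDescents (n+1) σ) +
        ((n:R) + 1 - cyclicDescents (n+1) σ) * f (cyclicDescents (n+1) σ + 1)) := by
  have h1 : ∀ σ : Equiv.Perm (Fin (n+1)),
      ((cyclicDescents (n+1) σ : R) * f (cyclicDescents (n+1) σ) +
        ((n:R) + 1 - cyclicDescents (n+1) σ) * f (cyclicDescents (n+1) σ + 1)) =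
      ∑ j : Fin (n+1), f (cyclicDescents (n+1) σ + if σ (j+1) < σ j then 0 else 1) := by
    intro σ
    have e : ∀ j : Fin (n+1), f (cyclicDescents (n+1) σ + if σ (j+1) < σ j then 0 else 1) =
       f (cyclicDescents (n+1) σ + 1) + (((if σ (j+1) < σ j then 1 else 0 : ℕ) : R)) *
        (f (cyclicDescents (n+1) σ) - f (cyclicDescents (n+1) σ + 1)) := by
      intro j
      split_ifs <;> simp
    rw [Finset.sum_congr rfl (fun j _ => e j), Finset.sum_add_distrib, ← Finset.sum_mul,
      ← Nat.cast_sum, ← cdes_eq]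
    simp
    ring
  rw [Finset.sum_congr rfl (fun σ _ => h1 σ), Finset.sum_comm]
  have h2 : ∀ j : Fin (n+1), (∑ σ : Equiv.Perm (Fin (n+1)),
      f (cyclicDescents (n+1) σ + if σ (j+1) < σ j then 0 else 1)) =
      ∑ σ : Equiv.Perm (Fin (n+1)),
        f (cyclicDescents (n+1) σ + if σ 0 < σ (Fin.last n) then 0 else 1) := by
    intro j
    refine Fintype.sum_equiv (Equiv.mulRight (Equiv.addRight (j+1))) _ _ ?_
    intro σ
    have : Fin.last n + (j + 1) = j := by
      rw [add_comm j, ← add_assoc, Fin.last_add_one, zero_add]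
    change _ = f (cyclicDescents (n+1) (σ * Equiv.addRight (j+1)) +
      if σ (0 + (j+1)) < σ (Fin.last n + (j+1)) then 0 else 1)
    rw [cdes_rot, this, zero_add]
  rw [Finset.sum_congr rfl (fun j _ => h2 j)]
  simp

lemma cdes_insert (n : ℕ) (τ : Equiv.Perm (Fin (n+1))) :
    cyclicDescents (n+2) (Equiv.Perm.decomposeFin.symm (0, τ)) =
      cyclicDescents (n+1) τ + if τ 0 < τ (Fin.last n) then 0 else 1 := by
  have e0 : Equiv.Perm.decomposeFin.symm (0, τ) 0 = 0 := by simp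
  have es : ∀ x : Fin (n+1), Equiv.Perm.decomposeFin.symm (0, τ) x.succ = (τ x).succ := by
    intro x; simp
  rw [cdes_eq (n+1), cdes_eq n, Fin.sum_univ_succ, Fin.sum_univ_castSucc,
    Fin.sum_univ_castSucc (n := n)]
  simp only [e0, es, Fin.last_add_one, Fin.succ_last]
  have h3 : ∀ i : Fin n, (i.castSucc.succ + 1 : Fin (n+2)) = i.succ.succ := by
    intro i; ext; simp [Fin.val_add_one, Fin.ext_iff]; omega
  have h4 : ∀ i : Fin n, (i.castSucc + 1 : Fin (n+1)) = i.succ := by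
    intro i; simp
  have h5 : Equiv.Perm.decomposeFin.symm (0, τ) (Fin.last (n+1)) = (τ (Fin.last n)).succ := by
    rw [← Fin.succ_last, es]
  simp only [h3, h4, es, h5, Fin.succ_lt_succ_iff, Fin.succ_pos, Fin.not_lt_zero, if_true,
    if_false]
  split_ifs <;> simp

lemma sum_rec {R : Type*} [CommRing R] (n : ℕ) (f : ℕ → R) :
    ((n:R)+1) * ∑ σ : Equiv.Perm (Fin (n+2)), f (cyclicDescents (n+2) σ) =
    ((n:R)+2) * ∑ σ : Equiv.Perm (Fin (n+1)),
      ((cyclicDescents (n+1) σ : R) * f (cyclicDescents (n+1) σ) +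
        ((n:R) + 1 - cyclicDescents (n+1) σ) * f (cyclicDescents (n+1) σ + 1)) := by
  rw [← sum_gap, sum_rot (n+1) f]
  have : (∑ σ : Equiv.Perm (Fin (n+2)), if σ 0 = 0 then f (cyclicDescents (n+2) σ) else 0) =
      ∑ σ : Equiv.Perm (Fin (n+1)),
        f (cyclicDescents (n+1) σ + if σ 0 < σ (Fin.last n) then 0 else 1) := by
    rw [← Equiv.sum_comp Equiv.Perm.decomposeFin.symm, Fintype.sum_prod_type]
    simp only [Equiv.Perm.decomposeFin_symm_apply_zero]
    rw [Finset.sum_eq_single 0]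
    · simp [cdes_insert]
    · intro b _ hb
      simp [hb]
    · simp
  rw [this]
  push_cast
  ring

lemma cdes_le (n : ℕ) (σ : Equiv.Perm (Fin n)) : cyclicDescents n σ ≤ n := by
  unfold cyclicDescents
  exact (Finset.card_le_univ _).trans (by simp)

lemma circ_mul (n l : ℕ) : (n+1) * circEulerian (n+1) l =
    (Finset.univ.filter (fun σ : Equiv.Perm (Fin (n+1)) => cyclicDescents (n+1) σ = l)).card := by
  unfold circEulerian
  apply Nat.mul_div_cancel'
  have h := sum_rot (R := ℤ) n (fun k => if k = l then 1 else 0)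
  rw [Finset.card_filter]
  apply Int.natCast_dvd_natCast.mp
  push_cast
  exact ⟨_, h⟩

lemma circ_symm (n l : ℕ) (h : l ≤ n + 2) :
    circEulerian (n+2) (n + 2 - l) = circEulerian (n+2) l := by
  have key : ∀ σ : Equiv.Perm (Fin (n+2)),
      cyclicDescents (n+2) (σ.trans Fin.revPerm) + cyclicDescents (n+2) σ = n + 2 := by
    intro σ
    rw [cdes_eq, cdes_eq, ← Finset.sum_add_distrib]
    have : ∀ i : Fin (n+2), ((if (σ.trans Fin.revPerm) (i+1) < (σ.trans Fin.revPerm) i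
        then 1 else 0) + if σ (i+1) < σ i then 1 else 0) = 1 := by
      intro i
      have hne : σ (i+1) ≠ σ i := by
        intro h
        have := σ.injective h
        simp at this
      simp only [Equiv.trans_apply, Fin.revPerm_apply, Fin.rev_lt_rev]
      rcases lt_or_gt_of_ne hne with h | h
      · simp [h, h.not_gt]
      · simp [h, h.not_gt]
    rw [Finset.sum_congr rfl (fun i _ => this i)]
    simp
  unfold circEulerian
  congr 1
  refine Finset.card_bij' (fun σ _ => σ.trans Fin.revPerm) (fun σ _ => σ.trans Fin.revPerm)
    ?_ ?_ ?_ ?_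
  · intro σ hs
    have := key σ
    simp only [Finset.mem_filter, Finset.mem_univ, true_and] at hs ⊢
    omega
  · intro σ hs
    have := key σ
    simp only [Finset.mem_filter, Finset.mem_univ, true_and] at hs ⊢
    omega
  · intro σ _; ext i; simp
  · intro σ _; ext i; simp

/-- generating polynomial of the circular Eulerian numbers -/
noncomputable def G (m : ℕ) : Polynomial ℂ :=
  ∑ l ∈ Finset.range (m+1), Polynomial.C (circEulerian m l : ℂ) * Polynomial.X ^ l

open Polynomial in
lemma G_F (n : ℕ) : ((n:ℂ[X])+1) * G (n+1) =
    ∑ σ : Equiv.Perm (Fin (n+1)), (X : ℂ[X]) ^ (cyclicDescents (n+1) σ) := by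
  rw [G, Finset.mul_sum, ← Finset.sum_fiberwise_of_maps_to (t := Finset.range (n+2))
    (g := cyclicDescents (n+1))]
  · refine Finset.sum_congr rfl fun l _ => ?_
    rw [Finset.sum_congr rfl (g := fun _ => (X:ℂ[X])^l)]
    · rw [Finset.sum_const, ← circ_mul]
      simp
      ring
    · intro σ hs
      simp at hs
      rw [hs]
  · intro σ _
    have := cdes_le (n+1) σ
    simp; omega

lemma G_one : G 1 = 1 := by
  have h := G_F 0
  simpa [cyclicDescents] using h

open Polynomial in
lemma G_succ (n : ℕ) : G (n+2) = X * (1 - X) * derivative (G (n+1)) +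
    ((n:ℂ[X]) + 1) * X * G (n+1) := by
  have hn : ((n:ℂ[X])+1) ≠ 0 := by exact_mod_cast (Nat.succ_ne_zero n)
  have hn2 : ((n:ℂ[X])+2) ≠ 0 := by exact_mod_cast (Nat.succ_ne_zero (n+1))
  have h1 := G_F n
  have h2 := G_F (n+1)
  have h3 := sum_rec n (fun k => (X:ℂ[X])^k)
  have hd : ((n:ℂ[X])+1) * derivative (G (n+1)) = ∑ σ : Equiv.Perm (Fin (n+1)),
      (cyclicDescents (n+1) σ : ℂ[X]) * (X : ℂ[X]) ^ (cyclicDescents (n+1) σ - 1) := by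
    have := congrArg derivative h1
    simpa [Polynomial.derivative_sum, Polynomial.derivative_X_pow] using this
  have hxd : ((n:ℂ[X])+1) * (X * derivative (G (n+1))) = ∑ σ : Equiv.Perm (Fin (n+1)),
      (cyclicDescents (n+1) σ : ℂ[X]) * (X : ℂ[X]) ^ (cyclicDescents (n+1) σ) := by
    rw [mul_left_comm, hd, Finset.mul_sum]
    refine Finset.sum_congr rfl fun σ _ => ?_
    rcases cyclicDescents (n+1) σ with _ | c
    · simp
    · simp [pow_succ]; ring
  have h4 : ∑ σ : Equiv.Perm (Fin (n+1)),
      ((cyclicDescents (n+1) σ : ℂ[X]) * (X : ℂ[X]) ^ (cyclicDescents (n+1) σ) +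
        ((n:ℂ[X]) + 1 - cyclicDescents (n+1) σ) * (X : ℂ[X]) ^ (cyclicDescents (n+1) σ + 1)) =
      ((n:ℂ[X])+1) * (X * derivative (G (n+1))) + ((n:ℂ[X])+1) * X * (((n:ℂ[X])+1) * G (n+1))
      - X * (((n:ℂ[X])+1) * (X * derivative (G (n+1)))) := by
    rw [hxd, h1, Finset.mul_sum, Finset.mul_sum, ← Finset.sum_add_distrib, ← Finset.sum_sub_distrib]
    refine Finset.sum_congr rfl fun σ _ => ?_
    ring
  rw [h4, ← h2] at h3
  apply mul_left_cancel₀ hn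
  apply mul_left_cancel₀ hn2
  push_cast at h3
  linear_combination h3

lemma circ_zero (n : ℕ) : circEulerian (n+2) 0 = 0 := by
  have h := congrArg (Polynomial.eval 0) (G_succ n)
  rw [G, Polynomial.eval_finsetSum, Finset.sum_range_succ'] at h
  simpa using h

noncomputable def chP (y : ℝ) (k : ℕ) : ℝ :=
  ∑ i ∈ Finset.range (k+1), (-y)^i * (Nat.choose (k+i) (2*i) : ℝ)

noncomputable def chQ (y : ℝ) (k : ℕ) : ℝ :=
  ∑ i ∈ Finset.range (k+1), (-y)^i * (Nat.choose (k+1+i) (2*i+1) : ℝ)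

lemma chP_ext (y : ℝ) (k M : ℕ) (h : k + 1 ≤ M) :
    ∑ i ∈ Finset.range M, (-y)^i * (Nat.choose (k+i) (2*i) : ℝ) = chP y k := by
  apply Finset.eventually_constant_sum _ h
  intro i hi
  rw [Nat.choose_eq_zero_of_lt (by omega)]
  simp

lemma chQ_ext (y : ℝ) (k M : ℕ) (h : k + 1 ≤ M) :
    ∑ i ∈ Finset.range M, (-y)^i * (Nat.choose (k+1+i) (2*i+1) : ℝ) = chQ y k := by
  apply Finset.eventually_constant_sum _ h
  intro i hi
  rw [Nat.choose_eq_zero_of_lt (by omega)]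
  simp

lemma chP_succ (y : ℝ) (k : ℕ) : chP y (k+1) = chP y k - y * chQ y k := by
  rw [← chP_ext y (k+1) (k+2) le_rfl, ← chP_ext y k (k+2) (by omega),
    ← chQ_ext y k (k+1) le_rfl, Finset.sum_range_succ', Finset.sum_range_succ' _ (k+1),
    Finset.mul_sum]
  have : ∀ i : ℕ, (-y)^(i+1) * (Nat.choose (k+1+(i+1)) (2*(i+1)) : ℝ) =
      (-y)^(i+1) * (Nat.choose (k+(i+1)) (2*(i+1)) : ℝ)
        - y * ((-y)^i * (Nat.choose (k+1+i) (2*i+1) : ℝ)) := by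
    intro i
    rw [show k+1+(i+1) = (k+1+i)+1 by ring, show 2*(i+1) = 2*i+1+1 by ring,
      Nat.choose_succ_succ, show k + (i+1) = k+1+i by ring]
    push_cast
    ring
  rw [Finset.sum_congr rfl (fun i _ => this i), Finset.sum_sub_distrib]
  simp
  ring

lemma chQ_succ (y : ℝ) (k : ℕ) : chQ y (k+1) = chQ y k + chP y (k+1) := by
  rw [← chP_ext y (k+1) (k+2) le_rfl, ← chQ_ext y k (k+2) (by omega),
    ← chQ_ext y (k+1) (k+2) le_rfl, ← Finset.sum_add_distrib]
  refine Finset.sum_congr rfl fun i _ => ?_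
  rw [show k+1+1+i = (k+1+i)+1 by ring, Nat.choose_succ_succ]
  push_cast
  ring

lemma chP_rec (y : ℝ) (k : ℕ) : chP y (k+2) = (2 - y) * chP y (k+1) - chP y k := by
  have h1 := chP_succ y (k+1)
  have h2 := chP_succ y k
  have h3 := chQ_succ y k
  rw [h1, h3]
  linear_combination -h2

lemma chP_cos (θ : ℝ) (k : ℕ) :
    chP (4 * Real.sin θ ^ 2) (k+1) + chP (4 * Real.sin θ ^ 2) k = 2 * Real.cos (2 * (k+1) * θ) := by
  have hc : 2 - 4 * Real.sin θ ^ 2 = 2 * Real.cos (2 * θ) := by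
    rw [Real.cos_two_mul, Real.sin_sq]; ring
  have h0 : chP (4 * Real.sin θ ^ 2) 0 = 1 := by simp [chP]
  have h1 : chP (4 * Real.sin θ ^ 2) 1 = 1 - 4 * Real.sin θ ^ 2 := by
    simp [chP, Finset.sum_range_succ]; ring
  induction k using Nat.strong_induction_on with
  | _ k ih =>
    match k with
    | 0 => simp only [zero_add, h0, h1]; push_cast; rw [show 2 * ((0:ℝ)+1) * θ = 2 * θ by ring]; linarith
    | 1 =>
      rw [chP_rec _ 0, zero_add, h0, h1, hc]
      push_cast
      rw [show 2 * ((1:ℝ)+1) * θ = 2 * (2 * θ) by ring, Real.cos_two_mul (2*θ)]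
      have : 4 * Real.sin θ ^ 2 = 2 - 2 * Real.cos (2*θ) := by linarith
      rw [this]; ring
    | k+2 =>
      have i1 := ih (k+1) (by omega)
      have i0 := ih k (by omega)
      have r1 := chP_rec (4 * Real.sin θ ^ 2) (k+1)
      have r0 := chP_rec (4 * Real.sin θ ^ 2) k
      rw [hc] at r1 r0
      have hcos : Real.cos (2 * (((k+2:ℕ):ℝ)+1) * θ) = 2 * Real.cos (2*θ) *
          Real.cos (2 * (((k+1:ℕ):ℝ)+1) * θ) - Real.cos (2 * ((k:ℝ)+1) * θ) := by
        push_cast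
        rw [show 2 * ((k:ℝ)+2+1) * θ = 2 * ((k:ℝ)+1+1) * θ + 2 * θ by ring,
          show 2 * ((k:ℝ)+1) * θ = 2 * ((k:ℝ)+1+1) * θ - 2 * θ by ring, Real.cos_add, Real.cos_sub]
        ring
      rw [hcos]
      linear_combination r1 + r0 + 2 * Real.cos (2*θ) * i1 - i0

/-- The normalised cosine. -/
noncomputable def hcos (k : ℕ) (θ : ℝ) : ℝ := if k = 0 then 1/2 else Real.cos (2 * k * θ)

lemma tCoeff_succ (k i : ℕ) (h : i ≤ k+1) (s : ℝ) :
    (-1)^(k+1) * tCoeff (k+1) i * s^(2*i) =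
      (1/2) * ((-(4 * s^2))^i * (Nat.choose (k+1+i) (2*i) : ℝ) +
        (-(4 * s^2))^i * (Nat.choose (k+i) (2*i) : ℝ)) := by
  have e1 : Nat.choose (k+1+i) (k+1-i) = Nat.choose (k+1+i) (2*i) := by
    rw [← Nat.choose_symm (by omega)]; congr 1; omega
  have e2 : ((k:ℝ)+1+i) * (Nat.choose (k+i) (2*i) : ℝ) =
      ((k:ℝ)+1-i) * (Nat.choose (k+1+i) (2*i) : ℝ) := by
    have := Nat.choose_mul_succ_eq (k+i) (2*i)
    have h2 : ((k + i + 1 - 2*i : ℕ) : ℝ) = (k:ℝ)+1-i := by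
      rw [Nat.cast_sub (by omega)]; push_cast; ring
    have h3 := congrArg (Nat.cast : ℕ → ℝ) this
    rw [Nat.cast_mul, Nat.cast_mul, h2] at h3
    rw [show k+1+i = k+i+1 by ring]
    push_cast at h3 ⊢
    linarith
  have hs : ((-1:ℝ))^(k+1) * (-1)^(k+1-i) = (-1)^i := by
    rw [← pow_add, show k+1+(k+1-i) = 2*(k+1-i) + i by omega, pow_add, pow_mul]; simp
  have hy : (-(4 * s^2))^i = (-1)^i * (2^(2*i) * s^(2*i)) := by
    rw [neg_pow, mul_pow, pow_mul, pow_mul]; norm_num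
  have hne : ((k:ℝ)+1+i) ≠ 0 := by positivity
  rw [tCoeff, if_neg (by omega), e1, hy, ← hs]
  have e3 : (Nat.choose (k+i) (2*i) : ℝ) =
      ((k:ℝ)+1-i) / ((k:ℝ)+1+i) * (Nat.choose (k+1+i) (2*i) : ℝ) := by
    rw [div_mul_eq_mul_div, ← e2]; field_simp
  rw [e3]
  push_cast
  field_simp
  ring

lemma cheb (k : ℕ) (θ : ℝ) :
    ∑ i ∈ Finset.range (k+1), (-1)^k * tCoeff k i * Real.sin θ ^(2*i) = hcos k θ := by
  rcases k with _ | k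
  · simp [tCoeff, hcos]
  · rw [Finset.sum_congr rfl (fun i hi => tCoeff_succ k i (by simp at hi; omega) _),
      ← Finset.mul_sum, Finset.sum_add_distrib, chP_ext _ _ _ le_rfl, chP_ext _ _ _ (by omega),
      chP_cos]
    simp [hcos]

lemma aCoeff_sum (n : ℕ) (θ : ℝ) (hs : Real.sin θ ≠ 0) :
    ∑ i ∈ Finset.Icc 1 n, aCoeff n i * (1 / Real.sin θ ^ (2*i)) =
      (∑ l ∈ Finset.Icc 1 n, 2 * (circEulerian (2*n) l : ℝ) * hcos (n-l) θ) /
        Real.sin θ ^ (2*n) := by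
  simp only [aCoeff, Finset.mul_sum, Finset.sum_mul]
  rw [Finset.sum_comm' (t' := Finset.Icc 1 n) (s' := fun l => Finset.Icc l n)
    (by intro x y; simp; omega), Finset.sum_div]
  refine Finset.sum_congr rfl fun l hl => ?_
  simp only [Finset.mem_Icc] at hl
  rw [← cheb, Finset.mul_sum, Finset.sum_div]
  refine Finset.sum_bij' (fun i _ => n - i) (fun j _ => n - j) ?_ ?_ ?_ ?_ ?_
  · intro i hi; simp at hi ⊢; omega
  · intro i hi; simp at hi ⊢; omega
  · intro i hi; simp at hi ⊢; omega
  · intro i hi; simp at hi ⊢; omega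
  · intro i hi
    simp only [Finset.mem_Icc] at hi
    have : Real.sin θ ^ (2*n) = Real.sin θ ^ (2*i) * Real.sin θ ^ (2*(n-i)) := by
      rw [← pow_add]; congr 1; omega
    rw [this]
    field_simp

lemma exp_hcos (k : ℕ) (hk : k ≠ 0) (θ : ℝ) (q : ℂ) (hq : q = Complex.exp (2 * Complex.I * θ)) :
    q^k * (2 * (hcos k θ : ℂ)) = 1 + q^(2*k) := by
  rw [hcos, if_neg hk]
  push_cast
  rw [Complex.cos, hq, ← Complex.exp_nat_mul, ← Complex.exp_nat_mul]
  rw [mul_div_cancel₀ _ two_ne_zero, mul_add, ← Complex.exp_add, ← Complex.exp_add]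
  rw [add_comm, ← Complex.exp_zero]
  congr 2
  · ring
  · push_cast; ring

lemma one_sub_pow (n : ℕ) (θ : ℝ) (q : ℂ) (hq : q = Complex.exp (2 * Complex.I * θ)) :
    (1 - q)^(2*n) = (-4)^n * (Real.sin θ : ℂ)^(2*n) * q^n := by
  have h : (1-q)^2 = (-4) * (Real.sin θ : ℂ)^2 * q := by
    rw [Complex.ofReal_sin, Complex.sin, hq]
    have e : Complex.exp (2 * Complex.I * θ) = Complex.exp (θ * Complex.I)^2 := by
      rw [← Complex.exp_nat_mul]; congr 1; push_cast; ring
    have e2 : Complex.exp (-θ * Complex.I) * Complex.exp (θ * Complex.I) = 1 := by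
      rw [← Complex.exp_add]; simp
    rw [e]
    linear_combination (-(Complex.exp (-θ * Complex.I) * Complex.exp (θ * Complex.I)) - 1
      + 2 * Complex.exp (θ * Complex.I)^2) * e2 
      + (Complex.exp (-θ * Complex.I) - Complex.exp (θ * Complex.I))^2 * 
        Complex.exp (θ * Complex.I)^2 * Complex.I_sq
  rw [pow_mul, h, mul_pow, mul_pow, ← pow_mul]

lemma G_eval (n : ℕ) (hn : 1 ≤ n) (θ : ℝ) (q : ℂ) (hq : q = Complex.exp (2 * Complex.I * θ)) :
    (G (2*n)).eval q = q^n *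
      ((∑ l ∈ Finset.Icc 1 n, 2 * (circEulerian (2*n) l : ℝ) * hcos (n-l) θ : ℝ) : ℂ) := by
  obtain ⟨m, hm⟩ : ∃ m, 2 * n = m + 2 := ⟨2*n-2, by omega⟩
  have h0 : circEulerian (2*n) 0 = 0 := by rw [hm]; exact circ_zero m
  have hsym : ∀ l ≤ 2*n, circEulerian (2*n) (2*n-l) = circEulerian (2*n) l := by
    rw [hm]; exact fun l h => circ_symm m l h
  have hS : ∑ l ∈ Finset.Icc 1 n, 2 * (circEulerian (2*n) l : ℝ) * hcos (n-l) θ =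
      ∑ l ∈ Finset.range (n+1), 2 * (circEulerian (2*n) l : ℝ) * hcos (n-l) θ := by
    apply Finset.sum_subset
    · intro l hl; simp at hl ⊢; omega
    · intro l hl hl2
      have : l = 0 := by simp at hl hl2; omega
      simp [this, h0]
  rw [hS, G, Polynomial.eval_finsetSum]
  simp only [Polynomial.eval_mul, Polynomial.eval_C, Polynomial.eval_pow, Polynomial.eval_X]
  rw [show 2*n+1 = n + (n+1) by ring, Finset.sum_range_add, ← Finset.sum_range_reflect _ (n+1),
    Finset.sum_range_succ, Finset.sum_range_succ, ← add_assoc, ← Finset.sum_add_distrib]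
  push_cast
  rw [mul_add, Finset.mul_sum]
  congr 1
  · refine Finset.sum_congr rfl fun l hl => ?_
    simp only [Finset.mem_range] at hl
    rw [show n + (n - l) = 2*n - l by omega, hsym l (by omega)]
    have := exp_hcos (n-l) (by omega) θ q hq
    have e1 : q^n = q^l * q^(n-l) := by rw [← pow_add]; congr 1; omega
    have e2 : q^(2*n-l) = q^l * q^(2*(n-l)) := by rw [← pow_add]; congr 1; omega
    rw [e1, e2]
    linear_combination -(circEulerian (2*n) l : ℂ) * q^l * this
  · simp [hcos]
    ring

/-- `q = exp(2πiz)` -/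
noncomputable def qq (z : ℂ) : ℂ := Complex.exp (2 * π * Complex.I * z)

noncomputable def hh (m : ℕ) (z : ℂ) : ℂ := (G m).eval (qq z) / (1 - qq z)^m

lemma hasDerivAt_qq (z : ℂ) : HasDerivAt qq (2 * π * Complex.I * qq z) z := by
  have := ((hasDerivAt_id z).const_mul (2 * π * Complex.I)).cexp
  refine this.congr_deriv ?_
  simp [qq, mul_comm]

lemma hasDerivAt_hh (m : ℕ) (z : ℂ) (hz : qq z ≠ 1) :
    HasDerivAt (hh (m+1)) (2 * π * Complex.I * hh (m+2) z) z := by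
  have hq := hasDerivAt_qq z
  have hne : 1 - qq z ≠ 0 := sub_ne_zero.mpr hz.symm
  have h1 : HasDerivAt (fun z => (G (m+1)).eval (qq z)) _ z :=
    ((G (m+1)).hasDerivAt (qq z)).comp z hq
  have h2 := (hq.const_sub 1).fun_pow (m+1)
  have h3 := h1.fun_div h2 (pow_ne_zero _ hne)
  refine h3.congr_deriv ?_
  rw [hh, G_succ]
  simp only [Polynomial.eval_add, Polynomial.eval_mul, Polynomial.eval_sub, Polynomial.eval_X,
    Polynomial.eval_one, Polynomial.eval_natCast]
  rw [div_eq_iff (by positivity), mul_div_assoc', div_mul_eq_mul_div,  eq_div_iff (by positivity)]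
  push_cast
  ring

lemma qq_ne_one {z : ℂ} (hz : z ∈ UpperHalfPlane.upperHalfPlaneSet) : qq z ≠ 1 := by
  intro h
  have := UpperHalfPlane.norm_exp_two_pi_I_lt_one ⟨z, hz⟩
  rw [qq] at h
  simp only [h] at this
  simp at this

lemma iter_cot_s11 (k : ℕ) {z : ℂ} (hz : z ∈ UpperHalfPlane.upperHalfPlaneSet) :
    iteratedDerivWithin k (fun x : ℂ ↦ π * Complex.cot (π * x)) UpperHalfPlane.upperHalfPlaneSet z =
      -(2 * π * Complex.I)^(k+1) * hh (k+1) z + if k = 0 then π * Complex.I else 0 := by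
  induction k generalizing z with
  | zero =>
    have hne : 1 - qq z ≠ 0 := sub_ne_zero.mpr (qq_ne_one hz).symm
    have hI := Complex.I_ne_zero
    simp only [iteratedDerivWithin_zero, Complex.cot_pi_eq_exp_ratio, hh, zero_add, G_one]
    rw [← qq, Polynomial.eval_one, if_pos trivial]
    field_simp
    linear_combination (qq z + 1) * Complex.I_sq
  | succ k ih =>
    rw [iteratedDerivWithin_succ, derivWithin_congr (fun y hy => ih hy) (ih hz)]
    have := ((hasDerivAt_hh k z (qq_ne_one hz)).const_mul
      (-(2 * π * Complex.I)^(k+1))).add_const (if k = 0 then π * Complex.I else 0)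
    rw [this.hasDerivWithinAt.derivWithin
      (UpperHalfPlane.isOpen_upperHalfPlaneSet.uniqueDiffOn z hz)]
    simp
    ring

lemma sum_upper (n : ℕ) (hn : 1 ≤ n) {z : ℂ} (hz : z ∈ UpperHalfPlane.upperHalfPlaneSet) :
    (Nat.factorial (2*n-1) : ℂ) * ∑' j : ℤ, 1 / (z + j) ^ (2*n) =
      (2 * π * Complex.I)^(2*n) * hh (2*n) z := by
  have h1 := iter_cot_s11 (2*n-1) hz
  rw [iteratedDerivWithin_cot_pi_mul_eq_mul_tsum_div_pow (by omega) hz, if_neg (by omega),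
    show 2*n-1+1 = 2*n by omega] at h1
  have : ((-1:ℂ))^(2*n-1) = -1 := Odd.neg_one_pow ⟨n-1, by omega⟩
  rw [this] at h1
  linear_combination -h1

lemma summable_real (n : ℕ) (hn : 1 ≤ n) (x : ℂ) :
    Summable (fun j : ℤ => 1 / (x + j) ^ (2*n)) := by
  have := EisensteinSeries.linear_right_summable x 1 (k := ((2*n:ℕ):ℤ)) (by omega)
  simp only [zpow_natCast] at this
  simpa using this

open Topology in
lemma sum_real_s11 (n : ℕ) (hn : 1 ≤ n) (x : ℝ) (hx : Real.sin (π * x) ≠ 0) :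
    (Nat.factorial (2*n-1) : ℂ) * ∑' j : ℤ, 1 / ((x:ℂ) + j) ^ (2*n) =
      (2 * π * Complex.I)^(2*n) * hh (2*n) x := by
  have hxj : ∀ j : ℤ, x + j ≠ 0 := by
    intro j h
    apply hx
    have : x = ((-j : ℤ) : ℝ) := by push_cast; linarith
    rw [this, mul_comm]
    exact Real.sin_int_mul_pi _
  have hq : qq x ≠ 1 := by
    intro h
    rw [qq, Complex.exp_eq_one_iff] at h
    obtain ⟨j, hj⟩ := h
    have h2 : (2 * π * Complex.I) * ((x:ℂ) - j) = 0 := by linear_combination hj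
    have h3 : (2 * (π:ℂ) * Complex.I) ≠ 0 := by simp [Real.pi_ne_zero]
    have h4 := (mul_eq_zero.mp h2).resolve_left h3
    have h5 : x - j = 0 := by exact_mod_cast h4
    apply hxj (-j)
    push_cast; linarith
  have hl : Tendsto (fun e : ℝ => (x:ℂ) + e * Complex.I) (𝓝[>] 0) (𝓝 (x:ℂ)) := by
    have : Continuous (fun e : ℝ => (x:ℂ) + e * Complex.I) := by fun_prop
    have h := this.tendsto 0
    simp only [Complex.ofReal_zero, zero_mul, add_zero] at h
    exact h.mono_left nhdsWithin_le_nhds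
  have hmem : ∀ᶠ e : ℝ in 𝓝[>] 0, (x:ℂ) + e * Complex.I ∈ UpperHalfPlane.upperHalfPlaneSet := by
    filter_upwards [self_mem_nhdsWithin] with e he
    simpa [UpperHalfPlane.upperHalfPlaneSet] using he
  have hR : Tendsto (fun e : ℝ => (2 * π * Complex.I)^(2*n) * hh (2*n) ((x:ℂ) + e * Complex.I))
      (𝓝[>] 0) (𝓝 ((2 * π * Complex.I)^(2*n) * hh (2*n) x)) := by
    apply Tendsto.const_mul
    obtain ⟨m, hm⟩ : ∃ m, 2*n = m+1 := ⟨2*n-1, by omega⟩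
    rw [hm]
    exact ((hasDerivAt_hh m _ hq).continuousAt.tendsto).comp hl
  have hL : Tendsto (fun e : ℝ => (Nat.factorial (2*n-1) : ℂ) *
      ∑' j : ℤ, 1 / (((x:ℂ) + e * Complex.I) + j) ^ (2*n))
      (𝓝[>] 0) (𝓝 ((Nat.factorial (2*n-1) : ℂ) * ∑' j : ℤ, 1 / ((x:ℂ) + j) ^ (2*n))) := by
    apply Tendsto.const_mul
    apply tendsto_tsum_of_dominated_convergence (bound := fun j : ℤ => ‖1 / ((x:ℂ) + j) ^ (2*n)‖)
    · exact (summable_real n hn x).norm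
    · intro j
      have hne : ((x:ℂ) + j) ^ (2*n) ≠ 0 := by
        apply pow_ne_zero
        exact_mod_cast hxj j
      exact Tendsto.div tendsto_const_nhds ((hl.add_const (j:ℂ)).pow (2*n)) hne
    · refine Eventually.of_forall fun e j => ?_
      have hpos : 0 < ‖((x:ℂ) + j)‖ := by
        rw [norm_pos_iff]; exact_mod_cast hxj j
      rw [norm_div, norm_div, norm_pow, norm_pow]
      gcongr
      have e1 : (x:ℂ) + j = ((x + j : ℝ) : ℂ) := by push_cast; rfl
      have e2 : x + j = ((x:ℂ) + e * Complex.I + j).re := by simp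
      rw [e1, Complex.norm_real, e2]
      exact Complex.abs_re_le_norm _
  refine tendsto_nhds_unique hL (hR.congr' ?_)
  filter_upwards [hmem] with e he
  exact (sum_upper n hn he).symm

lemma sum_trig (n : ℕ) (hn : 1 ≤ n) (x : ℝ) (hx : Real.sin (π * x) ≠ 0) :
    ((∑ i ∈ Finset.Icc 1 n, aCoeff n i * (1 / Real.sin (π * x) ^ (2*i)) : ℝ) : ℂ) * (π:ℂ)^(2*n) =
    (Nat.factorial (2*n-1) : ℂ) * ∑' j : ℤ, 1 / ((x:ℂ) + j) ^ (2*n) := by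
  have hq : qq x = Complex.exp (2 * Complex.I * ((π * x : ℝ):ℂ)) := by
    rw [qq]; congr 1; push_cast; ring
  have hq0 : qq x ≠ 0 := Complex.exp_ne_zero _
  have hs : ((Real.sin (π * x) : ℝ) : ℂ) ≠ 0 := by exact_mod_cast hx
  rw [sum_real_s11 n hn x hx, aCoeff_sum n _ hx, hh, G_eval n hn _ _ hq, one_sub_pow n _ _ hq]
  rw [Complex.ofReal_div, Complex.ofReal_pow]
  have h4 : (2 * (π:ℂ) * Complex.I)^(2*n) = (-4)^n * (π:ℂ)^(2*n) := by
    rw [pow_mul, pow_mul, ← mul_pow]; congr 1; ring_nf; simp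
  rw [h4]
  field_simp

lemma sum_zeta (N n : ℕ) (hN : 2 ≤ N) (hn : 1 ≤ n) :
    ∑ m ∈ Finset.Icc 1 (N-1), ∑' j : ℤ, 1 / ((((m:ℝ)/N : ℝ):ℂ) + j) ^ (2*n) =
      2 * ((N:ℂ)^(2*n) - 1) * riemannZeta ((2*n : ℕ) : ℂ) := by
  have : NeZero N := ⟨by omega⟩
  have hN0 : (N:ℂ) ≠ 0 := by exact_mod_cast (by omega : N ≠ 0)
  have hz := two_mul_riemannZeta_eq_tsum_int_inv_pow_of_even (k := 2*n) (by omega) (by simp)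
  have hsum : Summable (fun j : ℤ => 1 / ((j:ℂ)) ^ (2*n)) := by
    simpa using summable_real n hn 0
  have h1 : ∑' j : ℤ, 1 / ((j:ℂ)) ^ (2*n) =
      ∑ m ∈ Finset.range N, ∑' j : ℤ, 1 / ((m:ℂ) + N * j) ^ (2*n) := by
    rw [← (Int.divModEquiv N).symm.tsum_eq]
    have hs2 := (Int.divModEquiv N).symm.summable_iff.mpr hsum
    rw [← (Equiv.prodComm _ _).tsum_eq]
    have hs3 := (Equiv.prodComm (Fin N) ℤ).summable_iff.mpr hs2
    simp only [Function.comp_def] at hs3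
    rw [Summable.tsum_prod hs3, tsum_fintype,
      Finset.sum_range]
    refine Finset.sum_congr rfl fun m _ => tsum_congr fun j => ?_
    simp [Int.divModEquiv]
    ring
  have h2 : ∀ m : ℕ, ∑' j : ℤ, 1 / ((((m:ℝ)/N : ℝ):ℂ) + j) ^ (2*n) =
      (N:ℂ)^(2*n) * ∑' j : ℤ, 1 / ((m:ℂ) + N * j) ^ (2*n) := by
    intro m
    rw [← tsum_mul_left]
    refine tsum_congr fun j => ?_
    have : (((m:ℝ)/N : ℝ):ℂ) + j = ((m:ℂ) + N * j) / N := by push_cast; field_simp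
    rw [this, div_pow, one_div_div, mul_one_div]
  rw [Finset.sum_congr rfl (fun m _ => h2 m), ← Finset.mul_sum]
  have h3 : ∑ m ∈ Finset.range N, ∑' j : ℤ, 1 / ((m:ℂ) + N * j) ^ (2*n) =
      ∑' j : ℤ, 1 / ((N:ℂ) * j) ^ (2*n) +
      ∑ m ∈ Finset.Icc 1 (N-1), ∑' j : ℤ, 1 / ((m:ℂ) + N * j) ^ (2*n) := by
    have : Finset.range N = insert 0 (Finset.Icc 1 (N-1)) := by
      ext a; simp; omega
    rw [this, Finset.sum_insert (by simp)]
    simp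
  have h4 : (N:ℂ)^(2*n) * ∑' j : ℤ, 1 / ((N:ℂ) * j) ^ (2*n) = ∑' j : ℤ, 1 / ((j:ℂ)) ^ (2*n) := by
    rw [← tsum_mul_left]
    refine tsum_congr fun j => ?_
    rw [mul_pow]
    field_simp
  have hz' : 2 * riemannZeta ((2*n : ℕ) : ℂ) = ∑' j : ℤ, 1 / ((j:ℂ)) ^ (2*n) := by
    simpa using hz
  rw [h3] at h1
  linear_combination (-(N:ℂ)^(2*n)) * h1 - h4 - ((N:ℂ)^(2*n) - 1) * hz'

/-- For `N ≥ 2` and `n ≥ 1`,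
`(N^{2n} - 1) ζ(2n) = (π^{2n} / (2(2n-1)!)) ∑_{i=1}^{n} a_{n,i} ζ_{ℤ/Nℤ}(i)`, where
`ζ_{ℤ/Nℤ}(i) = ∑_{m=1}^{N-1} 1/sin^{2i}(mπ/N)`. -/
theorem zeta_eq_spectral_zeta_sum (N n : ℕ) (hN : 2 ≤ N) (hn : 1 ≤ n) :
    ((N : ℂ) ^ (2 * n) - 1) * riemannZeta ((2 * n : ℕ) : ℂ) =
      ((π : ℂ) ^ (2 * n) / (2 * (Nat.factorial (2 * n - 1) : ℂ))) *
        ∑ i ∈ Finset.Icc 1 n, (aCoeff n i : ℂ) *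
          ((∑ m ∈ Finset.Icc 1 (N - 1),
              1 / (Real.sin ((m : ℝ) * π / N)) ^ (2 * i) : ℝ) : ℂ) := by
  have hfac : (Nat.factorial (2 * n - 1) : ℂ) ≠ 0 := by exact_mod_cast Nat.factorial_ne_zero _
  have hpi : (π : ℂ) ≠ 0 := by exact_mod_cast Real.pi_ne_zero
  have key : (π : ℂ) ^ (2 * n) * (∑ i ∈ Finset.Icc 1 n, (aCoeff n i : ℂ) *
          ((∑ m ∈ Finset.Icc 1 (N - 1),
              1 / (Real.sin ((m : ℝ) * π / N)) ^ (2 * i) : ℝ) : ℂ)) =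
      (Nat.factorial (2 * n - 1) : ℂ) *
        (2 * ((N:ℂ)^(2*n) - 1) * riemannZeta ((2*n : ℕ) : ℂ)) := by
    rw [← sum_zeta N n hN hn, Finset.mul_sum (s := Finset.Icc 1 (N - 1))]
    have h : ∀ m ∈ Finset.Icc 1 (N - 1), (Nat.factorial (2 * n - 1) : ℂ) *
        ∑' j : ℤ, 1 / ((((m:ℝ)/N : ℝ):ℂ) + j) ^ (2*n) = (π : ℂ) ^ (2 * n) *
        ∑ i ∈ Finset.Icc 1 n, (aCoeff n i : ℂ) *
          ((1 / (Real.sin ((m : ℝ) * π / N)) ^ (2 * i) : ℝ) : ℂ) := by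
      intro m hm
      simp only [Finset.mem_Icc] at hm
      have hNpos : (0:ℝ) < N := by exact_mod_cast (by omega : 0 < N)
      have hmN : (m:ℝ) < N := by exact_mod_cast (by omega : m < N)
      have hm0 : (0:ℝ) < m := by exact_mod_cast (by omega : 0 < m)
      have hsin : Real.sin (π * ((m:ℝ)/N)) ≠ 0 := by
        apply ne_of_gt
        apply Real.sin_pos_of_pos_of_lt_pi
        · positivity
        · have : (m:ℝ)/N < 1 := (div_lt_one hNpos).mpr hmN
          nlinarith [Real.pi_pos]
      rw [← sum_trig n hn _ hsin, mul_comm]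
      congr 1
      rw [Complex.ofReal_sum]
      refine Finset.sum_congr rfl fun i _ => ?_
      rw [Complex.ofReal_mul, show (m:ℝ) * π / N = π * ((m:ℝ)/N) by ring]
    rw [Finset.sum_congr rfl h, ← Finset.mul_sum, Finset.sum_comm]
    congr 1
    refine Finset.sum_congr rfl fun i _ => ?_
    rw [Complex.ofReal_sum, Finset.mul_sum]
  rw [div_mul_eq_mul_div, key]
  field_simp
end

section
/- Let χ be an even Dirichlet character modulo N (N > 2) and let n ≥ 1 be an integer. Then L_{ℤ/Nℤ}(n, χ) = 2 ∑_{i=1}^{n} c_{n,i} · (N^{2i}/π^{2i}) · L(2i, χ). -/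
open Finset Filter Real

lemma aux_choose_step (n m : ℕ) : ((m + (n+1)).choose (2*(n+1)+1) : ℝ) * ((2*n+2)*(2*n+3)) =
    ((m + n).choose (2*n+1) : ℝ) * ((m:ℝ)^2 - (n+1)^2) := by
  have h1 := Nat.add_one_mul_choose_eq (m+n) (2*n+2)
  have h2 := Nat.choose_succ_right_eq (m+n) (2*n+1)
  rcases Nat.lt_or_ge m (n+1) with h | h
  · rw [Nat.choose_eq_zero_of_lt (by omega), Nat.choose_eq_zero_of_lt (by omega)]; simp
  · obtain ⟨j, rfl⟩ := Nat.exists_eq_add_of_le h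
    have e : n + 1 + j + n - (2*n+1) = j := by omega
    rw [e] at h2
    have h1' : ((n+1+j+n+1 : ℕ):ℝ) * ((n+1+j+n).choose (2*n+2) : ℝ) =
      ((n+1+j+(n+1)).choose (2*(n+1)+1) : ℝ) * ((2*n+3 : ℕ):ℝ) := by exact_mod_cast h1
    have h2' : ((n+1+j+n).choose (2*n+2) : ℝ) * ((2*n+2 : ℕ):ℝ) =
      ((n+1+j+n).choose (2*n+1) : ℝ) * (j:ℝ) := by exact_mod_cast h2
    push_cast at h1' h2' ⊢
    linear_combination (-(2*n+2:ℝ)) * h1' + (2*n+j+2:ℝ) * h2'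

lemma aux_choose_poly (n : ℕ) : ∃ P : Polynomial ℝ, P.natDegree < n + 1 ∧
    ∀ m : ℕ, ((m + n).choose (2*n+1) : ℝ) = m * P.eval ((m:ℝ)^2) := by
  induction n with
  | zero => exact ⟨1, by simp, by simp⟩
  | succ n ih =>
    obtain ⟨P, hP, h⟩ := ih
    refine ⟨Polynomial.C (1/((2*n+2)*(2*n+3):ℝ)) * ((Polynomial.X - Polynomial.C ((n+1:ℝ)^2)) * P), ?_, ?_⟩
    · refine lt_of_le_of_lt (Polynomial.natDegree_C_mul_le _ _) ?_
      refine lt_of_le_of_lt Polynomial.natDegree_mul_le ?_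
      rw [Polynomial.natDegree_X_sub_C]; omega
    · intro m
      have := aux_choose_step n m
      rw [h m] at this
      simp only [Polynomial.eval_mul, Polynomial.eval_C, Polynomial.eval_sub, Polynomial.eval_X]
      have h0 : ((2*n+2)*(2*n+3):ℝ) ≠ 0 := by positivity
      rw [eq_comm, ← sub_eq_zero]
      field_simp
      linarith

lemma aux_choose_sum (n : ℕ) : ∃ e : ℕ → ℝ,
    ∀ m : ℕ, ((m + n).choose (2*n+1) : ℝ) = ∑ i ∈ range (n+1), e i * (m:ℝ)^(2*i+1) := by
  obtain ⟨P, hP, h⟩ := aux_choose_poly n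
  refine ⟨P.coeff, fun m => ?_⟩
  rw [h, Polynomial.eval_eq_sum_range' hP, mul_sum]
  refine sum_congr rfl fun i _ => ?_
  ring

lemma aux_sin_q (n : ℕ) (z : UpperHalfPlane) :
    HasSum (fun m : ℕ => (-4 : ℂ)^(n+1) * (((m+n).choose (2*n+1) : ℂ) *
      Complex.exp (2 * π * Complex.I * z)^m)) (1 / Complex.sin (π * z)^(2*n+2)) := by
  set w := Complex.exp (π * Complex.I * z) with hw
  have hq : Complex.exp (2 * π * Complex.I * z) = w^2 := by
    rw [hw, ← Complex.exp_nat_mul]; congr 1; push_cast; ring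
  have hw0 : w ≠ 0 := Complex.exp_ne_zero _
  have hlt : ‖w^2‖ < 1 := by
    rw [← hq]; exact UpperHalfPlane.norm_exp_two_pi_I_lt_one z
  have h1 : (1 - w^2) ≠ 0 := by
    intro h
    rw [← sub_eq_zero.mp h] at hlt
    simp at hlt
  have hsin : Complex.sin (π * z) ^ 2 = -(1-w^2)^2/(4*w^2) := by
    have : Complex.sin (π * z) = (w⁻¹ - w) * Complex.I / 2 := by
      rw [Complex.sin, hw, ← Complex.exp_neg]; ring_nf
    rw [this]; field_simp; rw [Complex.I_sq]; ring
  have hs : 1 / Complex.sin (π * z)^(2*n+2) = (-4)^(n+1) * ((w^2)^(n+1) * (1/(1-w^2)^(2*n+1+1))) := by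
    rw [show 2*n+2 = 2*(n+1) by ring, pow_mul, hsin, pow_mul (1-w^2)]
    rw [mul_one_div, ← div_pow, ← mul_pow, ← one_div_pow]
    congr 1
    field_simp
  rw [hs, hq]
  refine HasSum.mul_left _ ?_
  have H := (hasSum_choose_mul_geometric_of_norm_lt_one (2*n+1) hlt).mul_left ((w^2)^(n+1))
  rw [← hasSum_nat_add_iff' (n+1), sum_eq_zero, sub_zero]
  · refine H.congr_fun ?_
    intro j
    rw [show j + (n+1) + n = j + (2*n+1) by ring]; ring
  · intro i hi
    rw [Nat.choose_eq_zero_of_lt (by simp at hi; omega)]; simp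

lemma aux_upper (n : ℕ) : ∃ d : ℕ → ℝ, ∀ z : UpperHalfPlane,
    1 / Complex.sin (π * z)^(2*n+2) =
      ∑ i ∈ range (n+1), (d i : ℂ) * ∑' k : ℤ, 1 / ((z:ℂ) + k)^(2*i+2) := by
  obtain ⟨e, he⟩ := aux_choose_sum n
  refine ⟨fun i => (-4)^(n+1) * e i * ((2*i+1).factorial / ((-4)^(i+1) * π^(2*i+2))), fun z => ?_⟩
  have hpi : (π:ℂ) ≠ 0 := by exact_mod_cast Real.pi_ne_zero
  have hS (i : ℕ) : Summable fun m : ℕ => (m:ℂ)^(2*i+1) * Complex.exp (2 * π * Complex.I * z)^m := by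
    exact summable_pow_mul_geometric_of_norm_lt_one _ (UpperHalfPlane.norm_exp_two_pi_I_lt_one z)
  rw [← (aux_sin_q n z).tsum_eq]
  have : ∀ i : ℕ, ∑' k : ℤ, 1 / ((z:ℂ) + k)^(2*i+2) = ((-4)^(i+1) * π^(2*i+2)/ (2*i+1).factorial) *
      ∑' m : ℕ, (m:ℂ)^(2*i+1) * Complex.exp (2 * π * Complex.I * z)^m := by
    intro i
    rw [EisensteinSeries.qExpansion_identity (k := 2*i+1) (by omega) z]
    congr 2
    rw [show 2*i+1+1 = 2*(i+1) by ring, pow_mul, pow_mul (π:ℂ), ← mul_pow]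
    congr 1
    ring_nf; rw [Complex.I_sq]; ring
  simp_rw [this]
  have h2 : ∀ i ∈ range (n+1), (((-4)^(n+1) * e i * ((2*i+1).factorial / ((-4)^(i+1) * π^(2*i+2))) : ℝ) : ℂ) *
     (((-4)^(i+1) * π^(2*i+2)/ (2*i+1).factorial) *
      ∑' m : ℕ, (m:ℂ)^(2*i+1) * Complex.exp (2 * π * Complex.I * z)^m) =
      ∑' m : ℕ, (-4)^(n+1) * e i * ((m:ℂ)^(2*i+1) * Complex.exp (2 * π * Complex.I * z)^m) := by
    intro i _
    rw [tsum_mul_left, ← mul_assoc]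
    congr 1
    have := Nat.factorial_ne_zero (2*i+1)
    push_cast
    field_simp
  rw [sum_congr rfl h2, ← Summable.tsum_finsetSum]
  · refine tsum_congr fun m => ?_
    have := congrArg (fun r : ℝ => (r:ℂ)) (he m)
    push_cast at this
    rw [this, sum_mul, mul_sum]
    refine sum_congr rfl fun i _ => ?_
    ring
  · exact fun i _ => (hS i).mul_left _

lemma aux_summable (x : ℝ) (i : ℕ) : Summable fun k : ℤ => 1 / |x + k|^(2*i+2) := by
  have := (Real.summable_one_div_int_add_rpow x ((2*i+2 : ℕ):ℝ)).mpr (by push_cast; linarith [(Nat.cast_nonneg i : (0:ℝ) ≤ i)])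
  simp_rw [Real.rpow_natCast] at this
  exact this.congr fun k => by rw [add_comm]

lemma aux_real (n : ℕ) : ∃ d : ℕ → ℝ, ∀ x : ℝ, Complex.sin (π * x) ≠ 0 → (∀ k : ℤ, x + k ≠ 0) → 
    1 / Complex.sin (π * x)^(2*n+2) =
      ∑ i ∈ range (n+1), (d i : ℂ) * ∑' k : ℤ, 1 / ((x:ℂ) + k)^(2*i+2) := by
  obtain ⟨d, hd⟩ := aux_upper n
  refine ⟨d, fun x hx hk => ?_⟩
  have ht : Tendsto (fun ε : ℝ => (x:ℂ) + ε * Complex.I) (nhdsWithin 0 (Set.Ioi 0)) (nhds x) := by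
    have : Continuous (fun ε : ℝ => (x:ℂ) + ε * Complex.I) := by fun_prop
    have := this.tendsto 0
    simp only [Complex.ofReal_zero, zero_mul, add_zero] at this
    exact this.mono_left nhdsWithin_le_nhds
  have h1 : Tendsto (fun ε : ℝ => 1 / Complex.sin (π * ((x:ℂ) + ε * Complex.I))^(2*n+2))
      (nhdsWithin 0 (Set.Ioi 0)) (nhds (1 / Complex.sin (π * x)^(2*n+2))) := by
    refine Tendsto.div tendsto_const_nhds ?_ (pow_ne_zero _ hx)
    exact ((Complex.continuous_sin.tendsto _).comp (ht.const_mul _)).pow _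
  have h2 : Tendsto (fun ε : ℝ => ∑ i ∈ range (n+1), (d i : ℂ) * ∑' k : ℤ, 1 / (((x:ℂ) + ε * Complex.I) + k)^(2*i+2))
      (nhdsWithin 0 (Set.Ioi 0)) (nhds (∑ i ∈ range (n+1), (d i : ℂ) * ∑' k : ℤ, 1 / ((x:ℂ) + k)^(2*i+2))) := by
    refine tendsto_finsetSum _ fun i _ => Tendsto.const_mul _ ?_
    refine tendsto_tsum_of_dominated_convergence (aux_summable x i) ?_ ?_
    · intro k
      refine Tendsto.div tendsto_const_nhds ((ht.add_const _).pow _) (pow_ne_zero _ ?_)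
      exact_mod_cast hk k
    · refine Eventually.of_forall fun ε k => ?_
      rw [norm_div, norm_one, norm_pow]
      have h0 : 0 < |x + k| := abs_pos.mpr (hk k)
      have : |x + k| ≤ ‖(x:ℂ) + ε * Complex.I + k‖ := by
        have := Complex.abs_re_le_norm ((x:ℂ) + ε * Complex.I + k)
        simpa using this
      gcongr
  refine tendsto_nhds_unique_of_eventuallyEq h1 h2 ?_
  filter_upwards [self_mem_nhdsWithin] with ε hε
  exact hd ⟨(x:ℂ) + ε * Complex.I, by simpa using hε⟩

lemma aux_bound (n : ℕ) (d : ℕ → ℝ) (hd : ∀ x : ℝ, Complex.sin (π * x) ≠ 0 → (∀ k : ℤ, x + k ≠ 0) → 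
    1 / Complex.sin (π * x)^(2*n+2) =
      ∑ i ∈ range (n+1), (d i : ℂ) * ∑' k : ℤ, 1 / ((x:ℂ) + k)^(2*i+2)) :
    ∃ C : ℝ, ∀ x : ℝ, 0 < x → x ≤ 1/2 →
      |1 / Real.sin (π * x)^(2*n+2) - ∑ i ∈ range (n+1), d i / x^(2*i+2)| ≤ C := by
  refine ⟨∑ i ∈ range (n+1), |d i| * ∑' k : ℤ, 2^(2*i+2) * (1 / |0 + (k:ℝ)|^(2*i+2)), fun x hx hx2 => ?_⟩
  have hs : Complex.sin (π * x) ≠ 0 := by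
    have : 0 < Real.sin (π * x) := Real.sin_pos_of_pos_of_lt_pi (by positivity) (by nlinarith [Real.pi_pos])
    exact_mod_cast this.ne'
  have hle : ∀ k : ℤ, k ≠ 0 → |0 + (k:ℝ)| / 2 ≤ |x + k| := by
    intro k hk
    have h1 : (1:ℝ) ≤ |(k:ℝ)| := by exact_mod_cast Int.one_le_abs hk
    have h2 := abs_sub_abs_le_abs_sub (k:ℝ) (-x)
    rw [abs_neg, abs_of_pos hx, sub_neg_eq_add, add_comm (k:ℝ)] at h2
    rw [zero_add]; linarith
  have hk : ∀ k : ℤ, x + k ≠ 0 := by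
    intro k h
    rcases eq_or_ne k 0 with rfl | hk
    · simp at h; exact hx.ne' h
    · have := hle k hk
      rw [h, zero_add, abs_zero] at this
      have h1 : (1:ℝ) ≤ |(k:ℝ)| := by exact_mod_cast Int.one_le_abs hk
      linarith
  have hsum : ∀ i, Summable fun k : ℤ => 1 / ((x:ℂ) + k)^(2*i+2) := by
    intro i
    refine Summable.of_norm ((aux_summable x i).congr fun k => ?_)
    rw [norm_div, norm_one, norm_pow, ← Real.norm_eq_abs, ← Complex.norm_real]
    push_cast; rfl
  have key := hd x hs hk
  rw [← Real.norm_eq_abs, ← Complex.norm_real]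
  push_cast
  rw [key, ← sum_sub_distrib]
  refine (norm_sum_le _ _).trans (sum_le_sum fun i _ => ?_)
  rw [(hsum i).tsum_eq_add_tsum_ite 0]
  have e : (d i:ℂ) * (1 / ((x:ℂ) + ((0:ℤ):ℂ))^(2*i+2) + ∑' k : ℤ, ite (k = 0) 0 (1 / ((x:ℂ) + k)^(2*i+2)))
     - d i / (x:ℂ)^(2*i+2) = d i * ∑' k : ℤ, ite (k = 0) 0 (1 / ((x:ℂ) + k)^(2*i+2)) := by
    push_cast; ring
  rw [e, norm_mul, Complex.norm_real, Real.norm_eq_abs]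
  refine mul_le_mul_of_nonneg_left ?_ (abs_nonneg _)
  refine tsum_of_norm_bounded ((aux_summable 0 i).mul_left _).hasSum fun k => ?_
  split_ifs with h
  · simp
  · have h1 : (1:ℝ) ≤ |(k:ℝ)| := by exact_mod_cast Int.one_le_abs h
    have h2 := hle k h
    rw [norm_div, norm_one, norm_pow]
    have h3 : ‖(x:ℂ) + k‖ = |x + k| := by
      rw [← Real.norm_eq_abs, ← Complex.norm_real]; push_cast; rfl
    rw [h3, mul_one_div, ← div_pow, ← one_div_pow]
    rw [zero_add] at h2 ⊢
    refine pow_le_pow_left₀ (by positivity) ?_ _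
    rw [div_le_div_iff₀ (by linarith) (by linarith)]; linarith

lemma aux_coeff (n : ℕ) (a : ℕ → ℝ) (C : ℝ) (h : ∀ᶠ x : ℝ in nhdsWithin 0 (Set.Ioi 0),
    |∑ i ∈ range (n+1), a i / x^(2*i+2)| ≤ C) : ∀ i ∈ range (n+1), a i = 0 := by
  set P : Polynomial ℝ := ∑ i ∈ range (n+1), Polynomial.C (a i) * Polynomial.X^(i+1) with hP
  have ht : Tendsto (fun y : ℝ => (√y)⁻¹) atTop (nhdsWithin 0 (Set.Ioi 0)) :=
    tendsto_inv_atTop_nhdsGT_zero.comp Real.tendsto_sqrt_atTop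
  have hb : P.degree ≤ 0 := by
    rw [← Polynomial.isBoundedUnder_abs_atTop_iff]
    refine ⟨C, ?_⟩
    rw [eventually_map]
    filter_upwards [ht.eventually h, eventually_gt_atTop 0] with y hy hy0
    refine le_of_eq_of_le (congrArg _ ?_) hy
    rw [hP, Polynomial.eval_finset_sum]
    refine sum_congr rfl fun i _ => ?_
    rw [show 2*i+2 = 2*(i+1) by ring, pow_mul, inv_pow, Real.sq_sqrt hy0.le]
    simp
  intro i hi
  have h0 : P.coeff (i+1) = 0 := Polynomial.coeff_eq_zero_of_degree_lt (lt_of_le_of_lt hb (by exact_mod_cast Nat.succ_pos i))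
  rw [hP, Polynomial.finsetSum_coeff] at h0
  simp only [Polynomial.coeff_C_mul, Polynomial.coeff_X_pow] at h0
  rw [sum_eq_single i] at h0
  · simpa using h0
  · intro j _ hj; simp [hj.symm]
  · intro h; exact absurd hi h

theorem graph_LFunction_eq_LFunction_sum (c : ℕ → ℕ → ℝ)
    (hc : ∀ g : ℕ, 1 ≤ g →
      Filter.Tendsto
        (fun x : ℝ => 1 / Real.sin x ^ (2 * g) - ∑ s ∈ Finset.range (g + 1), c g s / x ^ (2 * s))
        (nhdsWithin 0 {0}ᶜ) (nhds 0))
    (N : ℕ) [NeZero N] (hN : 2 < N) (χ : DirichletCharacter ℂ N) (heven : χ (-1) = 1)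
    (n : ℕ) (hn : 1 ≤ n) :
    ∑ m ∈ Finset.Icc 1 (N - 1), χ (m : ZMod N) / ((Real.sin ((m : ℝ) * π / N) : ℂ)) ^ (2 * n) =
      2 * ∑ i ∈ Finset.Icc 1 n, (c n i : ℂ) * ((N : ℂ) ^ (2 * i) / (π : ℂ) ^ (2 * i)) *
        DirichletCharacter.LFunction χ ((2 * i : ℕ) : ℂ) := by
  obtain ⟨n, rfl⟩ : ∃ k, n = k + 1 := ⟨n - 1, by omega⟩
  obtain ⟨d, hd⟩ := aux_real n
  obtain ⟨C, hC⟩ := aux_bound n d hd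
  have hpi := Real.pi_pos
  -- identification of the coefficients
  have hcd : ∀ i ∈ range (n+1), c (n+1) (i+1) / π^(2*i+2) - d i = 0 := by
    refine aux_coeff n _ (C + |c (n+1) 0| + 1) ?_
    have ht : Tendsto (fun t : ℝ => π * t) (nhdsWithin 0 (Set.Ioi 0)) (nhdsWithin 0 {0}ᶜ) := by
      refine tendsto_nhdsWithin_iff.mpr ⟨?_, ?_⟩
      · have : Continuous fun t : ℝ => π * t := by fun_prop
        have := this.tendsto 0
        rw [mul_zero] at this
        exact this.mono_left nhdsWithin_le_nhds
      · filter_upwards [self_mem_nhdsWithin] with t ht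
        exact (mul_pos hpi ht).ne'
    have h1 := ((hc (n+1) hn).comp ht).eventually (Metric.ball_mem_nhds 0 one_pos)
    have h2 : ∀ᶠ t : ℝ in nhdsWithin 0 (Set.Ioi 0), t ≤ 1/2 :=
      (eventually_le_nhds (by norm_num)).filter_mono nhdsWithin_le_nhds
    filter_upwards [h1, h2, self_mem_nhdsWithin] with t h1 h2 h3
    have h4 := hC t h3 h2
    simp only [Function.comp, Metric.mem_ball, dist_zero_right, Real.norm_eq_abs] at h1
    rw [sum_range_succ'] at h1
    have e : ∑ i ∈ range (n+1), (c (n+1) (i+1) / π^(2*i+2) - d i) / t^(2*i+2) =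
        ∑ i ∈ range (n+1), c (n+1) (i+1) / (π * t)^(2*(i+1)) - ∑ i ∈ range (n+1), d i / t^(2*i+2) := by
      rw [← sum_sub_distrib]
      refine sum_congr rfl fun i _ => ?_
      rw [sub_div, div_div, ← mul_pow]; rfl
    rw [e]
    rw [show 2*(n+1) = 2*n+2 by ring] at h1
    simp only [mul_zero, pow_zero, div_one] at h1
    generalize 1 / Real.sin (π * t)^(2*n+2) = S at h1 h4
    generalize ∑ i ∈ range (n+1), d i / t^(2*i+2) = D at h4 ⊢
    generalize ∑ i ∈ range (n+1), c (n+1) (i+1) / (π * t)^(2*(i+1)) = E at h1 ⊢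
    have h5 := neg_abs_le (c (n+1) 0)
    have h6 := le_abs_self (c (n+1) 0)
    rw [abs_lt] at h1
    rw [abs_le] at h4 ⊢
    constructor <;> linarith [h1.1, h1.2, h4.1, h4.2]
  have hNpos : (0:ℝ) < N := by exact_mod_cast (by omega : 0 < N)
  have hNC : (N:ℂ) ≠ 0 := by exact_mod_cast hNpos.ne'
  have hpiC : (π:ℂ) ≠ 0 := by exact_mod_cast hpi.ne'
  have hterm : ∀ m ∈ Icc 1 (N-1), χ (m : ZMod N) / ((Real.sin ((m : ℝ) * π / N) : ℂ)) ^ (2 * (n+1)) =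
     ∑ i ∈ range (n+1), χ (m : ZMod N) * ((d i : ℂ) * (2 * HurwitzZeta.hurwitzZetaEven (ZMod.toAddCircle (m : ZMod N)) ((2*(i+1) : ℕ) : ℂ))) := by
    intro m hm
    rw [mem_Icc] at hm
    have hm1 : (0:ℝ) < m := by exact_mod_cast hm.1
    have hm2 : (m:ℝ) < N := by exact_mod_cast (by omega : m < N)
    have hx0 : 0 < (m/N : ℝ) := by positivity
    have hx1 : (m/N : ℝ) < 1 := (div_lt_one hNpos).mpr hm2
    have hs : 0 < Real.sin (π * (m/N : ℝ)) :=
      Real.sin_pos_of_pos_of_lt_pi (by positivity) (by nlinarith)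
    have hk : ∀ k : ℤ, (m/N : ℝ) + k ≠ 0 := by
      intro k h
      have a1 : ((0:ℤ):ℝ) < ((-k : ℤ):ℝ) := by push_cast; linarith
      have a2 : ((-k : ℤ):ℝ) < ((1:ℤ):ℝ) := by push_cast; linarith
      rw [Int.cast_lt] at a1 a2
      omega
    have key := hd (m/N : ℝ) (by exact_mod_cast hs.ne') hk
    rw [div_eq_mul_one_div, show (m:ℝ) * π / N = π * (m/N : ℝ) by ring]
    rw [← mul_sum]
    congr 1
    rw [Complex.ofReal_sin, Complex.ofReal_mul, show 2*(n+1) = 2*n+2 by ring, key]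
    refine sum_congr rfl fun i _ => ?_
    congr 1
    rw [ZMod.toAddCircle_natCast]
    have H := HurwitzZeta.hasSum_int_hurwitzZetaEven (m/N : ℝ) (s := ((2*(i+1) : ℕ) : ℂ))
      (by rw [Complex.natCast_re]; exact_mod_cast (by omega : 1 < 2*(i+1)))
    rw [← H.tsum_eq, ← tsum_mul_left]
    refine tsum_congr fun k => ?_
    rw [Complex.cpow_natCast, ← Complex.ofReal_pow, Even.pow_abs (even_two_mul _)]
    push_cast
    rw [add_comm, show 2*(i+1) = 2*i+2 by ring]
    ring
  rw [sum_congr rfl hterm, sum_comm]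
  have hL : ∀ i : ℕ, DirichletCharacter.LFunction χ ((2 * (i+1) : ℕ) : ℂ) = ((N:ℂ)^(2*(i+1)))⁻¹ *
      ∑ m ∈ Icc 1 (N-1), χ (m : ZMod N) * HurwitzZeta.hurwitzZetaEven (ZMod.toAddCircle (m : ZMod N)) ((2*(i+1) : ℕ) : ℂ) := by
    intro i
    have hE : Function.Even (χ : ZMod N → ℂ) := by
      intro x
      rw [← neg_one_mul, map_mul, heven, one_mul]
    have hχ0 : χ (0 : ZMod N) = 0 := by
      haveI : Fact (1 < N) := ⟨by omega⟩
      exact χ.map_zero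
    rw [DirichletCharacter.LFunction, ZMod.LFunction_def_even hE, Complex.cpow_neg, Complex.cpow_natCast]
    congr 1
    set F : ZMod N → ℂ := fun j => χ j * HurwitzZeta.hurwitzZetaEven (ZMod.toAddCircle j) ((2*(i+1) : ℕ) : ℂ) with hF
    change ∑ j, F j = ∑ m ∈ Icc 1 (N-1), F (m : ZMod N)
    have h1 : ∑ j, F j = ∑ m ∈ range N, F (m : ZMod N) := by
      symm
      refine sum_bij (fun m _ => (m : ZMod N)) (by simp) ?_ ?_ (by simp)
      · intro a ha b hb hab
        have := congrArg ZMod.val hab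
        rwa [ZMod.val_natCast_of_lt (mem_range.mp ha), ZMod.val_natCast_of_lt (mem_range.mp hb)] at this
      · intro b _
        exact ⟨b.val, mem_range.mpr (ZMod.val_lt b), by simp⟩
    rw [h1]
    symm
    refine sum_subset (fun m hm => by simp at hm ⊢; omega) ?_
    intro m hm hm'
    have : m = 0 := by simp at hm hm'; omega
    subst this
    simp [hF, hχ0]
  have hI : ∀ f : ℕ → ℂ, ∑ i ∈ Icc 1 (n+1), f i = ∑ i ∈ range (n+1), f (i+1) := by
    intro f
    rw [range_eq_Ico, sum_Ico_add' f 0 (n+1) 1]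
    rfl
  rw [hI, mul_sum]
  refine sum_congr rfl fun i hi => ?_
  rw [hL i]
  have hdi : d i = c (n+1) (i+1) / π^(2*i+2) := by linarith [hcd i hi]
  rw [hdi, mul_sum, mul_sum, mul_sum]
  refine sum_congr rfl fun m _ => ?_
  push_cast
  rw [show 2*i+2 = 2*(i+1) by ring]
  field_simp
end

section
/- For all integers N ≥ 2 and n ≥ 1, ζ_{ℤ/Nℤ}(n) = 2 ∑_{i=1}^{n} c_{n,i} · ((N^{2i} − 1)/π^{2i}) · ζ(2i), where ζ is the Riemann zeta function. -/
open Finset Filter Real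

noncomputable def SS (k : ℕ) (y : ℝ) : ℝ := ∑' j : ℤ, ((y + j) ^ k)⁻¹

lemma SS_lb {d y : ℝ} (hd : 0 < d) (h1 : d ≤ y) (h2 : y ≤ 1 - d) (j : ℤ) :
    d / 2 * (1 + |(j : ℝ)|) ≤ |y + j| := by
  rcases le_or_gt 0 j with hj | hj
  · have hj' : (0 : ℝ) ≤ j := by exact_mod_cast hj
    rw [abs_of_nonneg hj', abs_of_nonneg (by linarith)]
    nlinarith
  · have hj' : (j : ℝ) ≤ -1 := by exact_mod_cast Int.le_sub_one_of_lt hj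
    rw [abs_of_neg (by linarith), abs_of_neg (by linarith)]
    nlinarith

lemma summable_one_add_abs {k : ℕ} (hk : 2 ≤ k) :
    Summable fun j : ℤ => ((1 + |(j : ℝ)|) ^ k)⁻¹ := by
  have h : Summable fun j : ℕ => ((1 + (j : ℝ)) ^ k)⁻¹ := by
    have := (summable_nat_add_iff 1).mpr (Real.summable_nat_pow_inv.mpr (by omega : 1 < k))
    refine this.congr fun j => ?_
    push_cast; ring_nf
  refine Summable.of_nat_of_neg ?_ ?_ <;> simpa using h

lemma SS_term_bound {d y : ℝ} (hd : 0 < d) (h1 : d ≤ y) (h2 : y ≤ 1 - d) (k : ℕ) (j : ℤ) :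
    |((y + j) ^ k)⁻¹| ≤ ((d / 2) ^ k)⁻¹ * ((1 + |(j : ℝ)|) ^ k)⁻¹ := by
  rw [abs_inv, abs_pow, ← mul_inv, ← mul_pow]
  have := SS_lb hd h1 h2 j
  gcongr

lemma exists_d {y : ℝ} (h0 : 0 < y) (h1 : y < 1) :
    ∃ d, 0 < d ∧ d < y ∧ y < 1 - d := by
  refine ⟨min y (1 - y) / 2, ?_, ?_, ?_⟩
  · have := lt_min h0 (sub_pos.2 h1); linarith
  · have := min_le_left y (1 - y); linarith
  · have := min_le_right y (1 - y); linarith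

lemma SS_summable {y : ℝ} (h0 : 0 < y) (h1 : y < 1) {k : ℕ} (hk : 2 ≤ k) :
    Summable fun j : ℤ => ((y + j) ^ k)⁻¹ := by
  obtain ⟨d, hd, h2, h3⟩ := exists_d h0 h1
  exact Summable.of_norm_bounded ((summable_one_add_abs hk).mul_left _)
    (fun j => SS_term_bound hd h2.le h3.le k j)

lemma ne_add_int {y : ℝ} (h0 : 0 < y) (h1 : y < 1) (j : ℤ) : y + j ≠ 0 := by
  obtain ⟨d, hd, h2, h3⟩ := exists_d h0 h1
  have := SS_lb hd h2.le h3.le j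
  intro h
  rw [h, abs_zero] at this
  have : 0 < d / 2 * (1 + |(j : ℝ)|) := by positivity
  linarith

lemma SS_term_deriv {k : ℕ} {y a : ℝ} (h : y + a ≠ 0) :
    HasDerivAt (fun y : ℝ => ((y + a) ^ k)⁻¹) (-k * ((y + a) ^ (k + 1))⁻¹) y := by
  have := ((((hasDerivAt_id y).add_const a).fun_pow k).fun_inv (pow_ne_zero k h))
  refine this.congr_deriv ?_
  rcases k with _ | k
  · simp
  · simp only [id]
    field_simp
    push_cast
    simp
    ring

lemma SS_deriv {y : ℝ} (h0 : 0 < y) (h1 : y < 1) {k : ℕ} (hk : 2 ≤ k) :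
    HasDerivAt (SS k) (-k * SS (k + 1) y) y := by
  obtain ⟨d, hd, h2, h3⟩ := exists_d h0 h1
  have := hasDerivAt_tsum_of_isPreconnected (𝕜 := ℝ) (t := Set.Ioo d (1 - d)) (y := y) (y₀ := y)
    (g := fun (j : ℤ) y => ((y + j) ^ k)⁻¹) (g' := fun (j : ℤ) y => -k * ((y + j) ^ (k + 1))⁻¹)
    (u := fun j : ℤ => k * (((d / 2) ^ (k + 1))⁻¹ * ((1 + |(j : ℝ)|) ^ (k + 1))⁻¹))
    (((summable_one_add_abs (by omega)).mul_left _).mul_left _) isOpen_Ioo isPreconnected_Ioo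
    (fun j z hz => SS_term_deriv (ne_add_int (hd.trans hz.1) (by linarith [hz.2]) j))
    (fun j z hz => by
      rw [norm_mul, norm_neg, Real.norm_natCast]
      gcongr
      exact SS_term_bound hd hz.1.le hz.2.le _ _)
    ⟨h2, h3⟩ (SS_summable h0 h1 hk) ⟨h2, h3⟩
  rw [tsum_mul_left] at this
  exact this

lemma cot_real {y : ℝ} (h0 : 0 < y) (h1 : y < 1) :
    π * Real.cot (π * y) - 1 / y = ∑' n : ℕ, (1 / (y - (n + 1)) + 1 / (y + (n + 1))) := by
  have := cot_series_rep' (x := (y : ℂ)) (by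
    rw [Complex.mem_integerComplement_iff]
    rintro ⟨j, hj⟩
    have hj : (j : ℝ) = y := by exact_mod_cast hj
    apply ne_add_int h0 h1 (-j)
    push_cast; linarith)
  exact_mod_cast this

lemma SS_two {y : ℝ} (h0 : 0 < y) (h1 : y < 1) :
    π ^ 2 / Real.sin (π * y) ^ 2 = SS 2 y := by
  obtain ⟨d, hd, h2, h3⟩ := exists_d h0 h1
  have hsin : ∀ z : ℝ, 0 < z → z < 1 → Real.sin (π * z) ≠ 0 := fun z hz hz' =>
    (Real.sin_pos_of_pos_of_lt_pi (by positivity) (by nlinarith [Real.pi_pos])).ne'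
  have hN (n : ℕ) (z : ℝ) : z + ((n : ℝ) + 1) = z + (((n : ℤ) + 1 : ℤ) : ℝ) := by push_cast; ring
  have hM (n : ℕ) (z : ℝ) : z - ((n : ℝ) + 1) = z + ((-((n : ℤ) + 1) : ℤ) : ℝ) := by
    push_cast; ring
  have hs := SS_summable h0 h1 (le_refl 2)
  have hs1 : Summable fun n : ℕ => ((y + ((n : ℝ) + 1)) ^ 2)⁻¹ := by
    simp_rw [hN]
    exact hs.comp_injective (i := fun n : ℕ => (n : ℤ) + 1) (fun a b h => by simpa using h)
  have hs2 : Summable fun n : ℕ => ((y - ((n : ℝ) + 1)) ^ 2)⁻¹ := by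
    simp_rw [hM]
    exact hs.comp_injective (i := fun n : ℕ => -((n : ℤ) + 1)) (fun a b h => by simpa using h)
  have hi : Function.Injective (fun n : ℕ => (n : ℤ) + 1) := fun a b h => by simpa using h
  have hu : Summable fun n : ℕ => 2 * (((d / 2) ^ 2)⁻¹ * ((1 + |(((n : ℤ) + 1 : ℤ) : ℝ)|) ^ 2)⁻¹) :=
    (((summable_one_add_abs (le_refl 2)).comp_injective hi).mul_left _).mul_left _
  have key := hasDerivAt_tsum_of_isPreconnected (𝕜 := ℝ) (t := Set.Ioo d (1 - d)) (y := y)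
    (y₀ := y)
    (g := fun (n : ℕ) y => 1 / (y - (n + 1)) + 1 / (y + (n + 1)))
    (g' := fun (n : ℕ) y => -((y - (n + 1)) ^ 2)⁻¹ + -((y + (n + 1)) ^ 2)⁻¹) hu
    isOpen_Ioo isPreconnected_Ioo
    (fun n z hz => by
      have hz0 := hd.trans hz.1
      have hz1 : z < 1 := by linarith [hz.2]
      have e1 := SS_term_deriv (k := 1) (ne_add_int hz0 hz1 (-((n : ℤ) + 1)))
      have e2 := SS_term_deriv (k := 1) (ne_add_int hz0 hz1 ((n : ℤ) + 1))
      simp_rw [← hM] at e1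
      simp_rw [← hN] at e2
      refine ((e1.fun_add e2).congr_deriv (by simp)).congr_of_eventuallyEq (.of_forall fun w => ?_)
      simp)
    (fun n z hz => by
      have e1 := SS_term_bound hd hz.1.le hz.2.le 2 ((n : ℤ) + 1)
      have e2 := SS_term_bound hd hz.1.le hz.2.le 2 (-((n : ℤ) + 1))
      simp_rw [← hM] at e2
      simp_rw [← hN] at e1
      refine (norm_add_le _ _).trans ?_
      rw [norm_neg, norm_neg, Real.norm_eq_abs, Real.norm_eq_abs]
      rw [Int.cast_neg, abs_neg] at e2
      linarith)
    ⟨h2, h3⟩ (by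
      have := summable_cotTerm (x := (y : ℂ)) (by
        rw [Complex.mem_integerComplement_iff]
        rintro ⟨j, hj⟩
        have hj : (j : ℝ) = y := by exact_mod_cast hj
        apply ne_add_int h0 h1 (-j)
        push_cast; linarith)
      simp only [cotTerm] at this
      exact_mod_cast this) ⟨h2, h3⟩
  have key2 : HasDerivAt (fun y => π * Real.cot (π * y) - 1 / y)
      (-(π ^ 2 / Real.sin (π * y) ^ 2) + (y ^ 2)⁻¹) y := by
    have a1 : HasDerivAt (fun y : ℝ => π * y) π y := by
      simpa using (hasDerivAt_id y).const_mul π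
    have a2 := (a1.cos.fun_div a1.sin (hsin y h0 h1)).const_mul π
    have a3 := a2.fun_sub (hasDerivAt_inv h0.ne')
    refine (a3.congr_deriv ?_).congr_of_eventuallyEq (.of_forall fun w => ?_)
    · have := hsin y h0 h1
      field_simp
      linear_combination (-y^2*π^2) * Real.sin_sq_add_cos_sq (π * y)
    · simp [Real.cot_eq_cos_div_sin]
  have key3 := key2.congr_of_eventuallyEq (f₁ := fun z : ℝ => ∑' n : ℕ, (1 / (z - (n + 1)) + 1 / (z + (n + 1)))) (by
    filter_upwards [isOpen_Ioo.mem_nhds (⟨h0, h1⟩ : y ∈ Set.Ioo (0 : ℝ) 1)] with z hz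
    exact (cot_real hz.1 hz.2).symm)
  have e := key.unique key3
  rw [Summable.tsum_add hs2.neg hs1.neg, tsum_neg, tsum_neg] at e
  rw [SS, tsum_of_add_one_of_neg_add_one]
  · simp only [← hM]
    push_cast
    simp only [add_zero]
    linarith
  · simpa using hs1
  · simpa [hM] using hs2

lemma sin_pi_ne {z : ℝ} (hz : 0 < z) (hz' : z < 1) : Real.sin (π * z) ≠ 0 :=
    (Real.sin_pos_of_pos_of_lt_pi (by positivity) (by nlinarith [Real.pi_pos])).ne'

lemma deriv_eq_of_eq {f g : ℝ → ℝ} {f' g' y : ℝ} (hy : y ∈ Set.Ioo (0 : ℝ) 1)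
    (h : ∀ z ∈ Set.Ioo (0 : ℝ) 1, f z = g z) (hf : HasDerivAt f f' y) (hg : HasDerivAt g g' y) :
    f' = g' := by
  refine (hf.congr_of_eventuallyEq (f₁ := g) ?_).unique hg
  filter_upwards [isOpen_Ioo.mem_nhds hy] with z hz using (h z hz).symm

lemma partial_fractions (n : ℕ) : ∃ a : ℕ → ℝ, ∀ y ∈ Set.Ioo (0 : ℝ) 1,
    (Real.sin (π * y) ^ (2 * (n + 1)))⁻¹ = ∑ i ∈ range (n + 1), a i * SS (2 * (i + 1)) y := by
  induction n with
  | zero =>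
    refine ⟨fun _ => (π ^ 2)⁻¹, fun y hy => ?_⟩
    simp only [zero_add, sum_range_one, mul_one]
    rw [← SS_two hy.1 hy.2]
    have := sin_pi_ne hy.1 hy.2
    field_simp
  | succ n ih =>
    obtain ⟨a, ha⟩ := ih
    have hd1 : ∀ y ∈ Set.Ioo (0 : ℝ) 1,
        -(2 * (n + 1)) * π * (Real.cos (π * y) * (Real.sin (π * y) ^ (2 * n + 3))⁻¹) =
        ∑ i ∈ range (n + 1), a i * (-(2 * (i + 1)) * SS (2 * (i + 1) + 1) y) := by
      intro y hy
      have hs := sin_pi_ne hy.1 hy.2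
      have a1 : HasDerivAt (fun y : ℝ => π * y) π y := by
        simpa using (hasDerivAt_id y).const_mul π
      refine deriv_eq_of_eq hy ha ?_ ?_
      · refine ((a1.sin.fun_pow (2 * (n + 1))).fun_inv (pow_ne_zero _ hs)).congr_deriv ?_
        rw [show 2 * (n + 1) - 1 = 2 * n + 1 by omega]
        push_cast
        field_simp
        ring
      · refine HasDerivAt.fun_sum fun i _ => ?_
        refine HasDerivAt.const_mul _ ?_
        have := SS_deriv hy.1 hy.2 (k := 2 * (i + 1)) (by omega)
        push_cast at this
        exact this
    have hd2 : ∀ y ∈ Set.Ioo (0 : ℝ) 1,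
        π ^ 2 * ((2 * (n + 1)) * (2 * n + 3) * (Real.sin (π * y) ^ (2 * (n + 1 + 1)))⁻¹
          - (2 * (n + 1)) ^ 2 * (Real.sin (π * y) ^ (2 * (n + 1)))⁻¹) =
        ∑ i ∈ range (n + 1), a i * (2 * (i + 1) * (2 * (i + 1) + 1) * SS (2 * (i + 1 + 1)) y) := by
      intro y hy
      have hs := sin_pi_ne hy.1 hy.2
      have a1 : HasDerivAt (fun y : ℝ => π * y) π y := by
        simpa using (hasDerivAt_id y).const_mul π
      refine deriv_eq_of_eq hy hd1 ?_ ?_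
      · refine ((a1.cos.fun_mul
          ((a1.sin.fun_pow (2 * n + 3)).fun_inv (pow_ne_zero _ hs))).const_mul
            (-(2 * (n + 1)) * π)).congr_deriv ?_
        rw [show 2 * n + 3 - 1 = 2 * n + 2 by omega]
        push_cast
        have h2 := Real.sin_sq_add_cos_sq (π * y)
        have h3 : Real.cos (π * y) ^ 2 = 1 - Real.sin (π * y) ^ 2 := by linarith
        generalize Real.sin (π * y) = s at *
        generalize Real.cos (π * y) = t at *
        have e1 : s ^ (2 * (n + 1 + 1)) = (s ^ n) ^ 2 * s ^ 4 := by ring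
        have e2 : s ^ (2 * (n + 1)) = (s ^ n) ^ 2 * s ^ 2 := by ring
        have e3 : s ^ (2 * n + 3) = (s ^ n) ^ 2 * s ^ 3 := by ring
        have e4 : s ^ (2 * n + 2) = (s ^ n) ^ 2 * s ^ 2 := by ring
        rw [e1, e2, e3, e4]
        have : s ^ n ≠ 0 := pow_ne_zero _ hs
        generalize s ^ n = q at *
        field_simp
        ring_nf
        rw [h3]
        ring
      · refine HasDerivAt.fun_sum fun i _ => ?_
        refine HasDerivAt.const_mul _ ?_
        have := (SS_deriv hy.1 hy.2 (k := 2 * (i + 1) + 1) (by omega)).const_mul (-(2 * ((i : ℝ) + 1)))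
        push_cast at this
        refine this.congr_deriv ?_
        rw [show 2 * (i + 1 + 1) = 2 * (i + 1) + 1 + 1 by ring]
        ring
    let C : ℝ := (2 * (n + 1)) * (2 * n + 3)
    have hC : C ≠ 0 := by positivity
    let A : ℕ → ℝ := fun i => Nat.casesOn i 0
      (fun j => a j * (2 * (j + 1) * (2 * (j + 1) + 1)) / (π ^ 2 * C))
    let B : ℕ → ℝ := fun i => if i < n + 1 then a i * (2 * (n + 1)) ^ 2 / C else 0
    refine ⟨fun i => A i + B i, fun y hy => ?_⟩
    have hA : ∑ i ∈ range (n + 1 + 1), A i * SS (2 * (i + 1)) y =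
        (∑ i ∈ range (n + 1), a i * (2 * (i + 1) * (2 * (i + 1) + 1) * SS (2 * (i + 1 + 1)) y))
          / (π ^ 2 * C) := by
      rw [sum_range_succ', sum_div]
      have hA0 : A 0 = 0 := rfl
      rw [hA0, zero_mul, add_zero]
      simp only [A]
      refine sum_congr rfl fun i _ => by ring
    have hB : ∑ i ∈ range (n + 1 + 1), B i * SS (2 * (i + 1)) y =
        (∑ i ∈ range (n + 1), a i * SS (2 * (i + 1)) y) * ((2 * (n + 1)) ^ 2 / C) := by
      rw [sum_range_succ, sum_mul]
      simp only [B, lt_irrefl, if_false, zero_mul, add_zero]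
      refine sum_congr rfl fun i hi => ?_
      rw [if_pos (mem_range.1 hi)]
      ring
    simp only [add_mul, sum_add_distrib]
    rw [hA, hB, ← ha y hy, ← hd2 y hy]
    have := Real.pi_ne_zero
    change _ = π ^ 2 * (C * _ - _) / _ + _
    field_simp
    ring

lemma SS_near_zero {k : ℕ} (hk : 2 ≤ k) : ∃ M : ℝ, ∀ y ∈ Set.Ioo (0 : ℝ) (1 / 2),
    |SS k y - (y ^ k)⁻¹| ≤ M := by
  have hsum : Summable fun j : ℤ => ((1 / 2) ^ k)⁻¹ * |1 / (j : ℝ) ^ k| :=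
    ((Real.summable_one_div_int_pow.2 (by omega)).abs).mul_left _
  refine ⟨∑' j : ℤ, ((1 / 2) ^ k)⁻¹ * |1 / (j : ℝ) ^ k|, fun y hy => ?_⟩
  have hs := SS_summable hy.1 (by linarith [hy.2]) hk
  rw [SS, hs.tsum_eq_add_tsum_ite 0]
  simp only [Int.cast_zero, add_zero, add_sub_cancel_left]
  rw [← Real.norm_eq_abs]
  refine tsum_of_norm_bounded hsum.hasSum fun j => ?_
  split_ifs with h
  · simp only [norm_zero]; positivity
  · rw [norm_inv, norm_pow, one_div (_ ^ k), abs_inv, abs_pow, ← mul_inv, ← mul_pow, Real.norm_eq_abs]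
    have : 1 / 2 * |(j : ℝ)| ≤ |y + j| := by
      have h1 : (1 : ℝ) ≤ |(j : ℝ)| := by exact_mod_cast Int.one_le_abs h
      have h2 := abs_sub_abs_le_abs_sub (j : ℝ) (-y)
      rw [abs_neg, abs_of_pos hy.1] at h2
      rw [show y + (j : ℝ) = j - -y by ring]
      linarith [hy.2]
    have : 0 < |(j : ℝ)| := abs_pos.2 (by exact_mod_cast h)
    gcongr

lemma polar_unique (n : ℕ) (b : ℕ → ℝ) (M δ : ℝ) (hδ : 0 < δ)
    (h : ∀ y ∈ Set.Ioo (0 : ℝ) δ, |∑ i ∈ range n, b i * (y ^ (2 * (i + 1)))⁻¹| ≤ M) :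
    ∀ i < n, b i = 0 := by
  let P : Polynomial ℝ := ∑ i ∈ range n, Polynomial.C (b i) * Polynomial.X ^ (i + 1)
  have hP : P.degree ≤ 0 := by
    rw [← Polynomial.isBoundedUnder_abs_atTop_iff]
    refine ⟨M, ?_⟩
    rw [eventually_map]
    filter_upwards [eventually_gt_atTop ((δ ^ 2)⁻¹), eventually_gt_atTop 0] with w hw hw0
    have := h (√w)⁻¹ ⟨by positivity, by
      rw [inv_lt_comm₀ (by positivity) hδ]
      apply Real.lt_sqrt_of_sq_lt
      rwa [inv_pow]⟩
    refine le_trans (le_of_eq (congrArg _ ?_)) this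
    simp only [P, Polynomial.eval_finsetSum]
    refine sum_congr rfl fun i _ => ?_
    simp [pow_mul, Real.sq_sqrt hw0.le]
  intro i hi
  have : P.coeff (i + 1) = 0 := by
    apply Polynomial.coeff_eq_zero_of_degree_lt
    exact lt_of_le_of_lt hP (by exact_mod_cast Nat.succ_pos i)
  simpa [P, Polynomial.finsetSum_coeff, Polynomial.coeff_X_pow, hi] using this

lemma SS_sum (N : ℕ) (hN : 2 ≤ N) {k : ℕ} (hk : 2 ≤ k) :
    ∑ m ∈ Icc 1 (N - 1), SS k (m / N) = (N ^ k - 1) * SS k 0 := by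
  have : NeZero N := ⟨by omega⟩
  have hN0 : (N : ℝ) ≠ 0 := by exact_mod_cast this.ne
  have hs : Summable fun j : ℤ => ((j : ℝ) ^ k)⁻¹ := by
    simpa using Real.summable_one_div_int_pow.2 (by omega : 1 < k)
  have h1 : SS k 0 = ∑ m : Fin N, ∑' j : ℤ, (((j * N + (m : ℕ) : ℤ) : ℝ) ^ k)⁻¹ := by
    rw [SS]
    simp only [zero_add]
    rw [← (Int.divModEquiv N).symm.tsum_eq, ← (Equiv.prodComm _ _).tsum_eq,
      Summable.tsum_prod, tsum_fintype]
    · rfl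
    · exact (Equiv.summable_iff (Equiv.prodComm _ _)).2 ((Equiv.summable_iff (Int.divModEquiv N).symm).2 hs)
  have h2 : ∑ m ∈ range N, SS k (m / N) = N ^ k * SS k 0 := by
    rw [h1, Finset.sum_range, mul_sum]
    refine sum_congr rfl fun m _ => ?_
    rw [SS, ← tsum_mul_left]
    refine tsum_congr fun j => ?_
    rw [show ((m : ℕ) : ℝ) / N + j = (((j * N + (m : ℕ) : ℤ) : ℝ)) / N by
      push_cast; field_simp; ring]
    rw [div_pow, inv_div]
    ring
  have h3 : range N = insert 0 (Icc 1 (N - 1)) := by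
    ext; simp; omega
  rw [h3, sum_insert (by simp)] at h2
  simp only [Nat.cast_zero, zero_div] at h2
  linarith

lemma SS_zeta (i : ℕ) (hi : 1 ≤ i) : ((SS (2 * i) 0 : ℝ) : ℂ) = 2 * riemannZeta ((2 * i : ℕ) : ℂ) := by
  rw [two_mul_riemannZeta_eq_tsum_int_inv_pow_of_even (by omega) (even_two_mul i), SS]
  push_cast
  simp

/-- Let `c g s` be the coefficient of `x^{-2s}` in the Laurent expansion of `(sin x)^{-2g}` at
`0`.  For `N ≥ 2` and `n ≥ 1`,
`ζ_{ℤ/Nℤ}(n) = 2 ∑_{i=1}^{n} c_{n,i} ((N^{2i} - 1)/π^{2i}) ζ(2i)`, where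
`ζ_{ℤ/Nℤ}(n) = ∑_{m=1}^{N-1} 1/sin^{2n}(mπ/N)`. -/
theorem spectral_zeta_eq_zeta_sum (c : ℕ → ℕ → ℝ)
    (hc : ∀ g : ℕ, 1 ≤ g →
      Filter.Tendsto
        (fun x : ℝ => 1 / Real.sin x ^ (2 * g) - ∑ s ∈ Finset.range (g + 1), c g s / x ^ (2 * s))
        (nhdsWithin 0 {0}ᶜ) (nhds 0))
    (N n : ℕ) (hN : 2 ≤ N) (hn : 1 ≤ n) :
    ((∑ m ∈ Finset.Icc 1 (N - 1), 1 / (Real.sin ((m : ℝ) * π / N)) ^ (2 * n) : ℝ) : ℂ) =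
      2 * ∑ i ∈ Finset.Icc 1 n, (c n i : ℂ) * (((N : ℂ) ^ (2 * i) - 1) / (π : ℂ) ^ (2 * i)) *
        riemannZeta ((2 * i : ℕ) : ℂ) := by
  obtain ⟨n, rfl⟩ : ∃ k, n = k + 1 := ⟨n - 1, by omega⟩
  obtain ⟨a, ha⟩ := partial_fractions n
  have hpi := Real.pi_pos
  -- identify the coefficients
  have hca : ∀ i < n + 1, c (n + 1) (i + 1) / π ^ (2 * (i + 1)) = a i := by
    have hM : ∀ i : ℕ, ∃ M : ℝ, ∀ y ∈ Set.Ioo (0 : ℝ) (1 / 2),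
        |SS (2 * (i + 1)) y - (y ^ (2 * (i + 1)))⁻¹| ≤ M := fun i => SS_near_zero (by omega)
    choose M hM using hM
    have h := hc (n + 1) (by omega)
    have h' := Metric.tendsto_nhds.1 h 1 one_pos
    rw [eventually_nhdsWithin_iff, Metric.eventually_nhds_iff] at h'
    obtain ⟨ε, hε, h'⟩ := h'
    have := polar_unique (n + 1) (fun i => a i - c (n + 1) (i + 1) / π ^ (2 * (i + 1)))
      (1 + |c (n + 1) 0| + ∑ i ∈ range (n + 1), |a i| * M i) (min (ε / π) (1 / 2))
      (by positivity) (by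
      intro y hy
      have hy1 := lt_of_lt_of_le hy.2 (min_le_left _ _)
      have hy2 := lt_of_lt_of_le hy.2 (min_le_right _ _)
      have hy0 := hy.1
      have hb := h' (y := π * y) (by
        rw [Real.dist_eq, sub_zero, abs_of_pos (by positivity)]
        rw [lt_div_iff₀ hpi] at hy1
        linarith) (by simp [hpi.ne', hy0.ne'])
      rw [Real.dist_eq, sub_zero, one_div, ha y ⟨hy0, by linarith⟩, sum_range_succ' (fun s => c (n + 1) s / _)] at hb
      simp only [mul_zero, pow_zero, div_one] at hb
      have hS : |∑ i ∈ range (n + 1), a i * (SS (2 * (i + 1)) y - (y ^ (2 * (i + 1)))⁻¹)| ≤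
          ∑ i ∈ range (n + 1), |a i| * M i := by
        refine (abs_sum_le_sum_abs _ _).trans (sum_le_sum fun i _ => ?_)
        rw [abs_mul]
        exact mul_le_mul_of_nonneg_left (hM i y ⟨hy0, hy2⟩) (abs_nonneg _)
      have e : ∑ i ∈ range (n + 1), (a i - c (n + 1) (i + 1) / π ^ (2 * (i + 1))) *
            (y ^ (2 * (i + 1)))⁻¹ =
          (∑ i ∈ range (n + 1), a i * SS (2 * (i + 1)) y -
            (∑ i ∈ range (n + 1), c (n + 1) (i + 1) / (π * y) ^ (2 * (i + 1)) + c (n + 1) 0)) +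
          c (n + 1) 0 -
          ∑ i ∈ range (n + 1), a i * (SS (2 * (i + 1)) y - (y ^ (2 * (i + 1)))⁻¹) := by
        rw [sub_add_eq_sub_sub, sub_add_cancel, ← sum_sub_distrib, ← sum_sub_distrib]
        refine sum_congr rfl fun i _ => ?_
        rw [mul_pow, div_mul_eq_div_div]
        ring
      rw [e]
      refine (abs_sub _ _).trans (add_le_add ((abs_add_le _ _).trans
        (add_le_add hb.le le_rfl)) hS))
    intro i hi
    have := this i hi
    linarith
  have hreal : ∑ m ∈ Finset.Icc 1 (N - 1), 1 / (Real.sin ((m : ℝ) * π / N)) ^ (2 * (n + 1)) =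
      ∑ i ∈ range (n + 1), c (n + 1) (i + 1) * (((N : ℝ) ^ (2 * (i + 1)) - 1) / π ^ (2 * (i + 1)))
        * SS (2 * (i + 1)) 0 := by
    calc _ = ∑ m ∈ Icc 1 (N - 1), ∑ i ∈ range (n + 1), a i * SS (2 * (i + 1)) (m / N) := by
          refine sum_congr rfl fun m hm => ?_
          rw [mem_Icc] at hm
          have hN' : (0 : ℝ) < N := by exact_mod_cast (by omega : 0 < N)
          have hm0 : (0 : ℝ) < m := by exact_mod_cast (by omega : 0 < m)
          have hm1 : (m : ℝ) < N := by exact_mod_cast (by omega : m < N)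
          rw [← ha (m / N) ⟨by positivity, (div_lt_one hN').2 hm1⟩, one_div,
            show (m : ℝ) * π / N = π * (m / N) by ring]
      _ = _ := by
          rw [sum_comm]
          refine sum_congr rfl fun i hi => ?_
          rw [← mul_sum, SS_sum N hN (by omega), ← hca i (mem_range.1 hi)]
          ring
  rw [hreal, ← Finset.Ico_add_one_right_eq_Icc, Finset.sum_Ico_eq_sum_range]
  push_cast
  rw [mul_sum]
  refine sum_congr rfl fun i _ => ?_
  rw [SS_zeta _ (by omega), add_comm i 1]
  push_cast
  ring
end
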